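/- arXiv:1003.1156 — 2 statements merged into one kernel-verified Lean document; each statement's English description precedes it below -/
import Mathlib

section
/- Let γ : [0,t] → ℝ^n be a nondegenerate classical path. Then there exist an open neighborhood O of (γ(0), γ(t)) in ℝ^n × ℝ^n and a smooth map γ̂ : [0,t] × O → ℝ^n such that: (i) for each (q_0,q_1) ∈ O the path γ̂(·,q_0,q_1) is a nondegenerate classical path of duration t; (ii) γ̂(0,q_0,q_1) = q_0 and γ̂(t,q_0,q_1) = q_1 for all (q_0,q_1) ∈ O; (iii) γ̂(·,γ(0),γ(t)) = γ. -/
open MeasureTheory Set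
open scoped BigOperators

noncomputable section

/-- Partial derivative of `f : ℝⁿ → ℝ` in the `j`-th coordinate direction. -/
def pd {n : ℕ} (f : (Fin n → ℝ) → ℝ) (j : Fin n) (q : Fin n → ℝ) : ℝ :=
  fderiv ℝ f q (Pi.single j 1)

/-- The classical equation of motion on the time interval `[0, t]`. -/
def IsClassical {n : ℕ} (B : Fin n → (Fin n → ℝ) → ℝ) (C : (Fin n → ℝ) → ℝ)
    (t : ℝ) (γ : ℝ → Fin n → ℝ) : Prop :=
  ∀ τ ∈ Icc (0:ℝ) t, ∀ i,
    deriv (deriv γ) τ i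
      + (∑ j, (pd (B i) j (γ τ) - pd (B j) i (γ τ)) * deriv γ τ j)
      + pd C i (γ τ) = 0

/-- The Jacobi operator `D_γ` (linearization of the equation of motion along `γ`). -/
def Jacobi {n : ℕ} (B : Fin n → (Fin n → ℝ) → ℝ) (C : (Fin n → ℝ) → ℝ)
    (γ ξ : ℝ → Fin n → ℝ) (τ : ℝ) (i : Fin n) : ℝ :=
  deriv (deriv ξ) τ i
    + (∑ j, (pd (B i) j (γ τ) - pd (B j) i (γ τ)) * deriv ξ τ j)
    + ∑ j, ((∑ k, pd (fun q => pd (B i) k q - pd (B k) i q) j (γ τ) * deriv γ τ k)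
        + pd (pd C i) j (γ τ)) * ξ τ j

/-- A classical path of duration `t` is nondegenerate if the only smooth based loop
annihilated by the Jacobi operator vanishes identically on `[0,t]`. -/
def Nondegenerate {n : ℕ} (B : Fin n → (Fin n → ℝ) → ℝ) (C : (Fin n → ℝ) → ℝ)
    (t : ℝ) (γ : ℝ → Fin n → ℝ) : Prop :=
  ∀ ξ : ℝ → Fin n → ℝ, ContDiff ℝ (⊤ : ℕ∞) ξ → ξ 0 = 0 → ξ t = 0 →
    (∀ τ ∈ Icc (0:ℝ) t, ∀ i, Jacobi B C γ ξ τ i = 0) →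
    ∀ τ ∈ Icc (0:ℝ) t, ξ τ = 0

/-- The action of a path of duration `t`. -/
def action {n : ℕ} (B : Fin n → (Fin n → ℝ) → ℝ) (C : (Fin n → ℝ) → ℝ)
    (t : ℝ) (γ : ℝ → Fin n → ℝ) : ℝ :=
  ∫ τ in (0:ℝ)..t,
    ((1:ℝ)/2 * ∑ i, deriv γ τ i ^ 2 + ∑ i, B i (γ τ) * deriv γ τ i - C (γ τ))

/-- A smooth family of nondegenerate classical paths with boundary values
`(t, q₀, q₁)` ranging over an open set `O ⊆ ℝ_{>0} × ℝⁿ × ℝⁿ`. -/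
structure SmoothFamily {n : ℕ} (B : Fin n → (Fin n → ℝ) → ℝ) (C : (Fin n → ℝ) → ℝ)
    (O : Set (ℝ × (Fin n → ℝ) × (Fin n → ℝ))) where
  f : ℝ → ℝ → (Fin n → ℝ) → (Fin n → ℝ) → Fin n → ℝ
  isOpen : IsOpen O
  pos : ∀ p ∈ O, 0 < p.1
  smooth : ContDiffOn ℝ (⊤ : ℕ∞)
      (fun p : ℝ × ℝ × (Fin n → ℝ) × (Fin n → ℝ) => f p.1 p.2.1 p.2.2.1 p.2.2.2)
      {p : ℝ × ℝ × (Fin n → ℝ) × (Fin n → ℝ) | p.2 ∈ O ∧ p.1 ∈ Icc 0 p.2.1}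
  pathSmooth : ∀ p ∈ O, ContDiff ℝ (⊤ : ℕ∞) fun τ => f τ p.1 p.2.1 p.2.2
  isClassical : ∀ p ∈ O, IsClassical B C p.1 fun τ => f τ p.1 p.2.1 p.2.2
  nondeg : ∀ p ∈ O, Nondegenerate B C p.1 fun τ => f τ p.1 p.2.1 p.2.2
  bdry0 : ∀ p ∈ O, f 0 p.1 p.2.1 p.2.2 = p.2.1
  bdry1 : ∀ p ∈ O, f p.1 p.1 p.2.1 p.2.2 = p.2.2

/-- The Hamilton function of a smooth family of classical paths. -/
def famS {n : ℕ} {B : Fin n → (Fin n → ℝ) → ℝ} {C : (Fin n → ℝ) → ℝ}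
    {O : Set (ℝ × (Fin n → ℝ) × (Fin n → ℝ))} (F : SmoothFamily B C O)
    (t : ℝ) (q0 q1 : Fin n → ℝ) : ℝ :=
  action B C t fun τ => F.f τ t q0 q1

/-- The mixed Hessian `(l, m) ↦ ∂²S/∂q₀^l∂q₁^m`. -/
def Hess01 {n : ℕ} (S : ℝ → (Fin n → ℝ) → (Fin n → ℝ) → ℝ)
    (t : ℝ) (q0 q1 : Fin n → ℝ) : Matrix (Fin n) (Fin n) ℝ :=
  Matrix.of fun l m =>
    fderiv ℝ (fun q0' => fderiv ℝ (fun q1' => S t q0' q1') q1 (Pi.single m 1)) q0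
      (Pi.single l 1)

/-- Heaviside's step function, with `Θ 0 = 1/2`. -/
def Heav (x : ℝ) : ℝ := if x < 0 then 0 else if x = 0 then 1/2 else 1

/-- The Green's kernel `G_γ` of a smooth family of nondegenerate classical paths. -/
def Green {n : ℕ} {B : Fin n → (Fin n → ℝ) → ℝ} {C : (Fin n → ℝ) → ℝ}
    {O : Set (ℝ × (Fin n → ℝ) × (Fin n → ℝ))} (F : SmoothFamily B C O)
    (t : ℝ) (q0 q1 : Fin n → ℝ) (ς τ : ℝ) (i j : Fin n) : ℝ :=
  Heav (ς - τ) * ∑ k, ∑ l,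
      fderiv ℝ (fun q => F.f ς t q q1 i) q0 (Pi.single k 1)
        * ((Hess01 (fun a b c => -(famS F a b c)) t q0 q1).transpose)⁻¹ k l
        * fderiv ℝ (fun q => F.f τ t q0 q j) q1 (Pi.single l 1)
  + Heav (τ - ς) * ∑ k, ∑ l,
      fderiv ℝ (fun q => F.f ς t q0 q i) q1 (Pi.single k 1)
        * (Hess01 (fun a b c => -(famS F a b c)) t q0 q1)⁻¹ k l
        * fderiv ℝ (fun q => F.f τ t q q1 j) q0 (Pi.single l 1)

/-- The Hessian of the action at a path `γ` of duration `t`, as a bilinear form. -/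
def hess {n : ℕ} (B : Fin n → (Fin n → ℝ) → ℝ) (C : (Fin n → ℝ) → ℝ)
    (t : ℝ) (γ ξ ζ : ℝ → Fin n → ℝ) : ℝ :=
  ∫ τ in (0:ℝ)..t,
    ((∑ i, deriv ξ τ i * deriv ζ τ i)
      + (∑ i, ∑ j, pd (B i) j (γ τ) * (deriv ξ τ i * ζ τ j + deriv ζ τ i * ξ τ j))
      + ∑ j, ∑ k,
          ((∑ i, pd (pd (B i) j) k (γ τ) * deriv γ τ i) - pd (pd C j) k (γ τ))
            * (ξ τ j * ζ τ k))

/-- The Jacobi fields `∂γ/∂q_a^j` of a smooth family (`a = 0` or `a = 1`). -/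
def jfield {n : ℕ} {B : Fin n → (Fin n → ℝ) → ℝ} {C : (Fin n → ℝ) → ℝ}
    {O : Set (ℝ × (Fin n → ℝ) × (Fin n → ℝ))} (F : SmoothFamily B C O)
    (t : ℝ) (q0 q1 : Fin n → ℝ) (a : Fin 2) (j : Fin n) : ℝ → Fin n → ℝ :=
  fun τ i =>
    if a = 0 then fderiv ℝ (fun q => F.f τ t q q1 i) q0 (Pi.single j 1)
    else fderiv ℝ (fun q => F.f τ t q0 q i) q1 (Pi.single j 1)

/-- Partial derivative of a function of `(t, q₀, q₁)` in the direction `q_a^j`. -/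
def pdS {n : ℕ} (S : ℝ → (Fin n → ℝ) → (Fin n → ℝ) → ℝ) (a : Fin 2) (j : Fin n)
    (t : ℝ) (q0 q1 : Fin n → ℝ) : ℝ :=
  if a = 0 then fderiv ℝ (fun q => S t q q1) q0 (Pi.single j 1)
  else fderiv ℝ (fun q => S t q0 q) q1 (Pi.single j 1)

open scoped ContDiff Topology

abbrev CI (E : Type) [NormedAddCommGroup E] := C(unitInterval, E)

/-- pointwise application -/
def mulOp {E F : Type} [NormedAddCommGroup E] [NormedSpace ℝ E]
    [NormedAddCommGroup F] [NormedSpace ℝ F] :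
    CI (E →L[ℝ] F) →L[ℝ] (CI E →L[ℝ] CI F) :=
  LinearMap.mkContinuous₂
    (LinearMap.mk₂ ℝ (fun (a : CI (E →L[ℝ] F)) (h : CI E) =>
      (⟨fun s => a s (h s), by fun_prop⟩ : CI F))
      (by intros; ext; simp) (by intros; ext; simp) (by intros; ext; simp) (by intros; ext; simp))
    1 (by
      intro a h
      rw [ContinuousMap.norm_le _ (by positivity)]
      intro s
      simp only [LinearMap.mk₂_apply, ContinuousMap.coe_mk, one_mul]
      exact ((a s).le_opNorm _).trans (mul_le_mul (a.norm_coe_le_norm s) (h.norm_coe_le_norm s)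
        (norm_nonneg _) (norm_nonneg _)))

@[simp] lemma mulOp_apply {E F : Type} [NormedAddCommGroup E] [NormedSpace ℝ E]
    [NormedAddCommGroup F] [NormedSpace ℝ F] (a : CI (E →L[ℝ] F)) (h : CI E) (s) :
    mulOp a h s = a s (h s) := rfl

lemma nem_hasFDerivAt {E F : Type} [NormedAddCommGroup E] [NormedSpace ℝ E]
    [NormedAddCommGroup F] [NormedSpace ℝ F] (G : C(E, F)) (G' : C(E, E →L[ℝ] F))
    (hG : ∀ x, HasFDerivAt G (G' x) x) (u : CI E) :
    HasFDerivAt (fun u : CI E => G.comp u) (mulOp (G'.comp u)) u := by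
  have hc : Continuous (fun u : CI E => G'.comp u) := ContinuousMap.continuous_postcomp G'
  rw [hasFDerivAt_iff_isLittleO_nhds_zero, Asymptotics.isLittleO_iff]
  intro ε hε
  obtain ⟨δ, hδ, h⟩ := (Metric.continuous_iff (α := CI E) (β := CI (E →L[ℝ] F))).1 hc u ε hε
  filter_upwards [Metric.ball_mem_nhds (0 : CI E) hδ] with k hk
  rw [mem_ball_zero_iff] at hk
  rw [ContinuousMap.norm_le _ (by positivity)]
  intro s
  have key := (convex_segment (u s) (u s + k s)).norm_image_sub_le_of_norm_hasFDerivWithin_le'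
    (f := G) (f' := G') (φ := G' (u s)) (C := ε) (x := u s) (y := u s + k s)
    (fun x _ => (hG x).hasFDerivWithinAt) ?_ (left_mem_segment _ _ _) (right_mem_segment _ _ _)
  · simp only [add_sub_cancel_left] at key
    refine key.trans ?_
    gcongr
    exact k.norm_coe_le_norm s
  · intro x hx
    rw [segment_eq_image'] at hx
    obtain ⟨θ, hθ, rfl⟩ := hx
    have h1 := h (u + θ • k) (by
      rw [dist_eq_norm, add_sub_cancel_left, norm_smul, Real.norm_of_nonneg hθ.1]
      nlinarith [norm_nonneg k, hθ.2])
    rw [dist_eq_norm] at h1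
    have h2 := (ContinuousMap.norm_coe_le_norm _ s).trans h1.le
    simpa using h2

lemma nem_contDiff_nat (m : ℕ) : ∀ {E F : Type} [NormedAddCommGroup E] [NormedSpace ℝ E]
    [NormedAddCommGroup F] [NormedSpace ℝ F] (G : C(E, F)) (_ : ContDiff ℝ ∞ G),
    ContDiff ℝ m (fun u : CI E => G.comp u) := by
  induction m with
  | zero =>
    intro E F _ _ _ _ G hG
    exact contDiff_zero.2 (ContinuousMap.continuous_postcomp G)
  | succ m ih =>
    intro E F _ _ _ _ G hG
    have h2 : ContDiff ℝ ∞ (fderiv ℝ G) := (contDiff_infty_iff_fderiv.1 hG).2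
    push_cast
    rw [contDiff_succ_iff_hasFDerivAt]
    refine ⟨fun u => mulOp ((⟨fderiv ℝ G, h2.continuous⟩ : C(E, E →L[ℝ] F)).comp u), ?_, ?_⟩
    · exact (ContinuousLinearMap.contDiff (E := CI (E →L[ℝ] F)) (F := CI E →L[ℝ] CI F)
        mulOp).comp (ih ⟨fderiv ℝ G, h2.continuous⟩ h2)
    · intro u
      exact nem_hasFDerivAt G _ (fun x => ((contDiff_infty_iff_fderiv.1 hG).1 x).hasFDerivAt) u

lemma nem_contDiff {E F : Type} [NormedAddCommGroup E] [NormedSpace ℝ E]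
    [NormedAddCommGroup F] [NormedSpace ℝ F] (G : C(E, F)) (hG : ContDiff ℝ ∞ G) :
    ContDiff ℝ ∞ (fun u : CI E => G.comp u) :=
  contDiff_infty.2 fun m => nem_contDiff_nat m G hG

/-- extension to the line -/
def extI {E : Type} [NormedAddCommGroup E] (u : CI E) : ℝ → E :=
  Set.IccExtend (zero_le_one' ℝ) u

lemma extI_cont {E : Type} [NormedAddCommGroup E] (u : CI E) : Continuous (extI u) :=
  u.continuous.Icc_extend'

lemma extI_apply {E : Type} [NormedAddCommGroup E] (u : CI E) (s : unitInterval) :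
    extI u s = u s := Set.IccExtend_val _ _ _

/-- integration operator -/
def volt {E : Type} [NormedAddCommGroup E] [NormedSpace ℝ E] : CI E →L[ℝ] CI E :=
  LinearMap.mkContinuous
    { toFun := fun u => ⟨fun s => ∫ r in (0:ℝ)..s, extI u r,
        (intervalIntegral.continuous_primitive
          (fun a b => (extI_cont u).intervalIntegrable a b) 0).comp continuous_subtype_val⟩
      map_add' := by
        intro u v; ext s
        simp only [ContinuousMap.coe_mk, ContinuousMap.add_apply]
        rw [← intervalIntegral.integral_add ((extI_cont u).intervalIntegrable _ _)
          ((extI_cont v).intervalIntegrable _ _)]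
        rfl
      map_smul' := by
        intro c u; ext s
        simp only [ContinuousMap.coe_mk, ContinuousMap.smul_apply, RingHom.id_apply]
        rw [← intervalIntegral.integral_smul]
        rfl } 1 (by
      intro u
      rw [ContinuousMap.norm_le _ (by positivity)]
      intro s
      have := intervalIntegral.norm_integral_le_of_norm_le_const (a := 0) (b := (s:ℝ))
        (f := extI u) (C := ‖u‖) (fun x _ => u.norm_coe_le_norm _)
      refine this.trans ?_
      rw [sub_zero, abs_of_nonneg s.2.1, one_mul]
      exact mul_le_of_le_one_right (norm_nonneg _) s.2.2)

lemma volt_apply {E : Type} [NormedAddCommGroup E] [NormedSpace ℝ E] (u : CI E) (s) :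
    volt u s = ∫ r in (0:ℝ)..s, extI u r := rfl

lemma volt_pow_bound {E : Type} [NormedAddCommGroup E] [NormedSpace ℝ E] (a : CI (E →L[ℝ] E))
    (u : CI E) (k : ℕ) : ∀ s : unitInterval,
    ‖((volt ∘L mulOp a) ^ k) u s‖ ≤ ‖a‖ ^ k * (s:ℝ) ^ k / k.factorial * ‖u‖ := by
  induction k with
  | zero => intro s; simpa using u.norm_coe_le_norm s
  | succ k ih =>
    intro s
    rw [pow_succ', mul_apply_eq_comp, ContinuousLinearMap.comp_apply, volt_apply]
    set w := ((volt ∘L mulOp a) ^ k) u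
    have hb : ∀ r ∈ Set.Ioc (0:ℝ) s, ‖extI (mulOp a w) r‖ ≤
        ‖a‖ ^ (k+1) / k.factorial * ‖u‖ * r ^ k := by
      intro r hr
      have hr' : r ∈ Set.Icc (0:ℝ) 1 := ⟨hr.1.le, hr.2.trans s.2.2⟩
      rw [extI_apply (mulOp a w) ⟨r, hr'⟩, mulOp_apply]
      calc _ ≤ ‖a ⟨r, hr'⟩‖ * ‖w ⟨r, hr'⟩‖ := ContinuousLinearMap.le_opNorm _ _
        _ ≤ ‖a‖ * (‖a‖ ^ k * r ^ k / k.factorial * ‖u‖) :=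
          mul_le_mul (a.norm_coe_le_norm _) (ih _) (norm_nonneg _) (norm_nonneg _)
        _ = _ := by ring
    have := intervalIntegral.norm_integral_le_of_norm_le (μ := MeasureTheory.volume) s.2.1
      (Filter.Eventually.of_forall hb)
      ((by fun_prop : Continuous fun r : ℝ =>
        ‖a‖ ^ (k+1) / k.factorial * ‖u‖ * r ^ k).intervalIntegrable _ _)
    refine this.trans (le_of_eq ?_)
    rw [intervalIntegral.integral_const_mul, integral_pow, Nat.factorial_succ]
    push_cast
    have : (k.factorial : ℝ) ≠ 0 := by positivity
    field_simp
    simp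

lemma volt_unit {E : Type} [NormedAddCommGroup E] [NormedSpace ℝ E] [CompleteSpace E]
    (a : CI (E →L[ℝ] E)) :
    IsUnit (1 - volt ∘L mulOp a : CI E →L[ℝ] CI E) := by
  set T : CI E →L[ℝ] CI E := volt ∘L mulOp a
  have hlim := FloorSemiring.tendsto_pow_div_factorial_atTop ‖a‖
  obtain ⟨k, hk⟩ := (hlim.eventually (gt_mem_nhds (zero_lt_one' ℝ))).exists
  have hT : ‖T ^ k‖ < 1 := by
    refine lt_of_le_of_lt (ContinuousLinearMap.opNorm_le_bound _ (by positivity) ?_) hk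
    intro u
    rw [ContinuousMap.norm_le _ (by positivity)]
    intro s
    refine (volt_pow_bound a u k s).trans ?_
    gcongr
    exact mul_le_of_le_one_right (by positivity) (pow_le_one₀ s.2.1 s.2.2)
  have h1 : IsUnit (1 - T ^ k) := isUnit_one_sub_of_norm_lt_one (R := CI E →L[ℝ] CI E) hT
  rw [← mul_neg_geom_sum] at h1
  have hcomm : Commute (1 - T) (∑ i ∈ Finset.range k, T ^ i) := by
    show _ * _ = _ * _
    rw [mul_neg_geom_sum, geom_sum_mul_neg]
  exact (hcomm.isUnit_mul_iff.1 h1).1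

lemma implicit_contDiffAt {P X : Type} [NormedAddCommGroup P] [NormedSpace ℝ P] [CompleteSpace P]
    [NormedAddCommGroup X] [NormedSpace ℝ X] [CompleteSpace X]
    (H2 : P × X → X) (hH : ContDiff ℝ ∞ H2) (U : P → X) (hU : ∀ p, H2 (p, U p) = 0)
    (uniq : ∀ p u, H2 (p, u) = 0 → u = U p) (p0 : P) (D : X →L[ℝ] X)
    (hD : HasFDerivAt (fun u => H2 (p0, u)) D (U p0)) (hu : IsUnit D) :
    ContDiffAt ℝ ∞ U p0 := by
  obtain ⟨D', rfl⟩ := hu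
  set L := fderiv ℝ H2 (p0, U p0) with hL
  have hLd : HasFDerivAt H2 L (p0, U p0) :=
    (hH.differentiable (by simp) (p0, U p0)).hasFDerivAt
  have hLD : ∀ h, L (0, h) = D'.1 h := by
    have h1 : HasFDerivAt (fun u => H2 (p0, u)) (L ∘L ContinuousLinearMap.inr ℝ P X) (U p0) :=
      HasFDerivAt.comp (U p0) (f := fun u => (p0, u)) (g := H2) hLd
        (hasFDerivAt_prodMk_right p0 (U p0))
    intro h
    rw [← h1.unique hD]; simp
  have hLs : ∀ dp h, L (dp, h) = L (dp, 0) + D'.1 h := by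
    intro dp h
    rw [← hLD, ← map_add]; simp
  have hinv : ∀ h, D'⁻¹.1 (D'.1 h) = h := fun h => by
    have := D'.inv_mul
    exact DFunLike.congr_fun this h
  have hinv' : ∀ h, D'.1 (D'⁻¹.1 h) = h := fun h => by
    have := D'.mul_inv
    exact DFunLike.congr_fun this h
  let A : (P × X) ≃L[ℝ] (P × X) := ContinuousLinearEquiv.equivOfInverse
    ((ContinuousLinearMap.fst ℝ P X).prod L)
    ((ContinuousLinearMap.fst ℝ P X).prod
      (D'⁻¹.1 ∘L (ContinuousLinearMap.snd ℝ P X - L ∘L (ContinuousLinearMap.inl ℝ P X ∘L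
        ContinuousLinearMap.fst ℝ P X))))
    (by
      rintro ⟨dp, h⟩
      have e := hLs dp h
      simp [e, hinv])
    (by
      rintro ⟨dp, h⟩
      simp only [ContinuousLinearMap.prod_apply, ContinuousLinearMap.coe_fst',
        ContinuousLinearMap.comp_apply, sub_apply,
        ContinuousLinearMap.coe_snd', ContinuousLinearMap.inl_apply]
      rw [hLs, hinv']; simp)
  let H : P × X → P × X := fun z => (z.1, H2 z)
  have hHc : ContDiff ℝ ∞ H := contDiff_fst.prodMk hH
  have hHd : HasFDerivAt H (A : (P × X) →L[ℝ] (P × X)) (p0, U p0) :=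
    hasFDerivAt_fst.prodMk hLd
  let e := hHc.contDiffAt.toOpenPartialHomeomorph H hHd (by simp)
  have hinvs := (hHc.contDiffAt (x := (p0, U p0))).to_localInverse hHd (by simp)
  have hH0 : H (p0, U p0) = (p0, 0) := by simp [H, hU]
  rw [hH0] at hinvs
  have htgt : (p0, (0:X)) ∈ e.target := by
    have := hHc.contDiffAt.image_mem_toOpenPartialHomeomorph_target hHd (by simp)
    rwa [hH0] at this
  have hev : U =ᶠ[𝓝 p0] fun p => ((hHc.contDiffAt (x := (p0, U p0))).localInverse hHd (by simp)
      (p, 0)).2 := by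
    have hcont : Filter.Tendsto (fun p : P => (p, (0:X))) (𝓝 p0) (𝓝 (p0, 0)) :=
      (by fun_prop : Continuous fun p : P => (p, (0:X))).tendsto p0
    filter_upwards [hcont (e.open_target.mem_nhds htgt)] with p hp
    have h1 : H (e.symm (p, 0)) = (p, 0) := e.right_inv hp
    have h2 : (e.symm (p, 0)).1 = p := congrArg Prod.fst h1
    have h3 : H2 (e.symm (p, 0)) = 0 := congrArg Prod.snd h1
    have h4 : H2 (p, (e.symm (p, 0)).2) = 0 := by
      have h5 : (p, (e.symm (p, 0)).2) = e.symm (p, 0) := Prod.ext h2.symm rfl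
      rw [h5, h3]
    exact (uniq _ _ h4).symm
  refine ContDiffAt.congr_of_eventuallyEq ?_ hev
  exact contDiffAt_snd.comp p0 (hinvs.comp p0 (contDiffAt_id.prodMk contDiffAt_const))

/-- constants -/
def constI {E : Type} [NormedAddCommGroup E] [NormedSpace ℝ E] : E →L[ℝ] CI E :=
  LinearMap.mkContinuous
    { toFun := fun x => ContinuousMap.const _ x
      map_add' := by intros; ext; simp
      map_smul' := by intros; ext; simp } 1 (by
      intro x
      rw [ContinuousMap.norm_le _ (by positivity)]
      intro s; simp)

@[simp] lemma constI_apply {E : Type} [NormedAddCommGroup E] [NormedSpace ℝ E] (x : E) (s) :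
    constI x s = x := rfl

lemma exists_sol {E : Type} [NormedAddCommGroup E] [NormedSpace ℝ E] [CompleteSpace E]
    (F : E → E) (K : NNReal) (hK : LipschitzWith K F) (M : NNReal) (hM : ∀ x, ‖F x‖ ≤ M)
    (x : E) (T : ℝ) (hT : 0 < T) :
    ∃ y : ℝ → E, y 0 = x ∧ ∀ s ∈ Ioo (-T) T, HasDerivAt y (F (y s)) s := by
  have hp : IsPicardLindelof (fun _ : ℝ => F) (tmin := -T) (tmax := T)
      ⟨0, by constructor <;> linarith⟩ x (M * ⟨T, hT.le⟩) 0 M K :=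
    { lipschitzOnWith := fun t _ => hK.lipschitzOnWith
      continuousOn := fun x _ => continuousOn_const
      norm_le := fun t _ x _ => hM x
      mul_max_le := by
        simp only [sub_zero, zero_sub, neg_neg, max_self, NNReal.coe_zero]
        exact le_rfl }
  obtain ⟨y, h0, hy⟩ := hp.exists_eq_forall_mem_Icc_hasDerivWithinAt₀
  exact ⟨y, h0, fun s hs => (hy s ⟨hs.1.le, hs.2.le⟩).hasDerivAt (Icc_mem_nhds hs.1 hs.2)⟩

lemma sol_unique {E : Type} [NormedAddCommGroup E] [NormedSpace ℝ E] [CompleteSpace E]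
    (F : C(E, E)) (K : NNReal) (hK : LipschitzWith K F) (τ : ℝ) (x : E) (u w : CI E)
    (hu : u - constI x - τ • volt (F.comp u) = 0)
    (hw : w - constI x - τ • volt (F.comp w) = 0) : u = w := by
  have key : ∀ u : CI E, u - constI x - τ • volt (F.comp u) = 0 →
      (∀ s : unitInterval, u s = x + τ • ∫ r in (0:ℝ)..s, extI (F.comp u) r) ∧
      (∀ s ∈ Ico (0:ℝ) 1, HasDerivWithinAt (fun s : ℝ => x + τ • ∫ r in (0:ℝ)..s, extI (F.comp u) r)
        (τ • F (x + τ • ∫ r in (0:ℝ)..s, extI (F.comp u) r)) (Ici s) s) ∧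
      Continuous (fun s : ℝ => x + τ • ∫ r in (0:ℝ)..s, extI (F.comp u) r) := by
    intro u hu
    have h1 : ∀ s : unitInterval, u s = x + τ • ∫ r in (0:ℝ)..s, extI (F.comp u) r := by
      intro s
      have := DFunLike.congr_fun hu s
      simp only [ContinuousMap.sub_apply, ContinuousMap.smul_apply, volt_apply, constI_apply,
        ContinuousMap.zero_apply] at this
      rw [sub_sub, sub_eq_zero] at this
      exact this
    have h2 : ∀ s, HasDerivAt (fun s : ℝ => x + τ • ∫ r in (0:ℝ)..s, extI (F.comp u) r)
        (τ • extI (F.comp u) s) s := fun s =>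
      (((extI_cont (F.comp u)).integral_hasStrictDerivAt 0 s).hasDerivAt.const_smul τ).const_add x
    refine ⟨h1, ?_, continuous_iff_continuousAt.2 fun s => (h2 s).continuousAt⟩
    intro s hs
    have h3 := (h2 s).hasDerivWithinAt (s := Ici s)
    have h4 := extI_apply (F.comp u) ⟨s, hs.1, hs.2.le⟩
    simp only [ContinuousMap.comp_apply] at h4
    rw [h1] at h4
    simp only at h4
    rwa [h4] at h3
  obtain ⟨a1, a2, a3⟩ := key u hu
  obtain ⟨b1, b2, b3⟩ := key w hw
  have := ODE_solution_unique (v := fun _ z => τ • F z) (K := ‖τ‖₊ * K)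
    (fun _ => (lipschitzWith_smul τ).comp hK)
    a3.continuousOn a2 b3.continuousOn b2 (by simp)
  ext s
  rw [a1, b1]
  exact this s.2

lemma sol_of_curve {E : Type} [NormedAddCommGroup E] [NormedSpace ℝ E] [CompleteSpace E]
    (F : C(E, E)) (x : E) (T : ℝ) (y : ℝ → E) (h0 : y 0 = x)
    (hy : ∀ s ∈ Ioo (-T) T, HasDerivAt y (F (y s)) s) (τ : ℝ) (hτ : τ ∈ Ioo (-T) T) :
    ∃ u : CI E, u - constI x - τ • volt (F.comp u) = 0 ∧ u 1 = y τ := by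
  have hmem : ∀ s ∈ Icc (0:ℝ) 1, s * τ ∈ Ioo (-T) T := by
    intro s hs
    have : |s * τ| < T := by
      rw [abs_mul, abs_of_nonneg hs.1]
      have := abs_lt.2 hτ
      nlinarith [abs_nonneg τ, hs.2]
    exact abs_lt.1 this
  have hd : ∀ s ∈ Icc (0:ℝ) 1, HasDerivAt (fun s => y (s * τ)) (τ • F (y (s * τ))) s := by
    intro s hs
    exact (hy _ (hmem s hs)).scomp s (by simpa using (hasDerivAt_id s).mul_const τ)
  let u : CI E := ⟨fun s => y (s * τ), by
    rw [continuous_iff_continuousAt]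
    intro s
    exact ContinuousAt.comp (f := fun s : unitInterval => (s:ℝ)) (g := fun s : ℝ => y (s * τ))
      (hd s s.2).continuousAt continuous_subtype_val.continuousAt⟩
  refine ⟨u, ?_, by simp [u]⟩
  ext s
  simp only [ContinuousMap.sub_apply, ContinuousMap.smul_apply, volt_apply, constI_apply,
        ContinuousMap.zero_apply]
  rw [← intervalIntegral.integral_smul]
  have := intervalIntegral.integral_eq_sub_of_hasDerivAt (a := 0) (b := (s:ℝ))
    (f := fun s => y (s * τ)) (f' := fun r => τ • extI (F.comp u) r) (by
      intro r hr
      rw [uIcc_of_le s.2.1] at hr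
      have hr' : r ∈ Icc (0:ℝ) 1 := ⟨hr.1, hr.2.trans s.2.2⟩
      rw [extI_apply (F.comp u) ⟨r, hr'⟩]
      exact hd r hr')
    (((extI_cont (F.comp u)).const_smul τ).intervalIntegrable _ _)
  rw [this]
  simp [u, h0]

theorem exists_flow {E : Type} [NormedAddCommGroup E] [NormedSpace ℝ E] [CompleteSpace E]
    (F : E → E) (hF : ContDiff ℝ ∞ F) (K : NNReal) (hK : LipschitzWith K F) (M : NNReal)
    (hM : ∀ x, ‖F x‖ ≤ M) :
    ∃ Φ : ℝ × E → E, ContDiff ℝ ∞ Φ ∧ (∀ x, Φ (0, x) = x) ∧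
      ∀ x τ, HasDerivAt (fun s => Φ (s, x)) (F (Φ (τ, x))) τ := by
  let Fc : C(E, E) := ⟨F, hF.continuous⟩
  have hFd : ContDiff ℝ ∞ (fderiv ℝ F) := (contDiff_infty_iff_fderiv.1 hF).2
  let Fd : C(E, E →L[ℝ] E) := ⟨fderiv ℝ F, hFd.continuous⟩
  let H2 : (ℝ × E) × CI E → CI E := fun z => z.2 - constI z.1.2 - z.1.1 • volt (Fc.comp z.2)
  have hH2 : ContDiff ℝ ∞ H2 := by
    have h1 : ContDiff ℝ ∞ (fun z : (ℝ × E) × CI E => volt (Fc.comp z.2)) :=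
      (ContinuousLinearMap.contDiff (E := CI E) (F := CI E) volt).comp ((nem_contDiff Fc hF).comp contDiff_snd)
    have h2 : ContDiff ℝ ∞ (fun z : (ℝ × E) × CI E => constI z.1.2) :=
      (ContinuousLinearMap.contDiff (E := E) (F := CI E) constI).comp (contDiff_snd.comp contDiff_fst)
    exact (contDiff_snd.sub h2).sub ((contDiff_fst.comp contDiff_fst).smul h1)
  have hex : ∀ p : ℝ × E, ∃ u, H2 (p, u) = 0 := by
    rintro ⟨τ, x⟩
    obtain ⟨y, h0, hy⟩ := exists_sol F K hK M hM x (|τ| + 1) (by positivity)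
    obtain ⟨u, hu, -⟩ := sol_of_curve Fc x (|τ| + 1) y h0 hy τ (abs_lt.1 (by linarith))
    exact ⟨u, hu⟩
  choose U hU using hex
  have huniq : ∀ p u, H2 (p, u) = 0 → u = U p := fun p u hu =>
    sol_unique Fc K hK p.1 p.2 u (U p) hu (hU p)
  have hUs : ContDiff ℝ ∞ U := by
    rw [contDiff_iff_contDiffAt]
    intro p0
    refine implicit_contDiffAt H2 hH2 U hU huniq p0
      (1 - volt ∘L mulOp (p0.1 • Fd.comp (U p0))) ?_ (volt_unit _)
    have h1 := nem_hasFDerivAt Fc Fd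
      (fun x => ((contDiff_infty_iff_fderiv.1 hF).1 x).hasFDerivAt) (U p0)
    have h2 : HasFDerivAt (fun u => H2 (p0, u))
        (ContinuousLinearMap.id ℝ (CI E) - p0.1 • (volt ∘L mulOp (Fd.comp (U p0)))) (U p0) :=
      ((hasFDerivAt_id (U p0)).sub_const (constI p0.2)).sub
        ((volt.hasFDerivAt.comp (U p0) h1).const_smul p0.1)
    have h3 : (1 - volt ∘L mulOp (p0.1 • Fd.comp (U p0)) : CI E →L[ℝ] CI E) =
        ContinuousLinearMap.id ℝ (CI E) - p0.1 • (volt ∘L mulOp (Fd.comp (U p0))) := by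
      rw [map_smul, ContinuousLinearMap.comp_smul]
      rfl
    rw [h3]
    exact h2
  have hΦ : ∀ x T y, y 0 = x → (∀ s ∈ Ioo (-T) T, HasDerivAt y (F (y s)) s) →
      ∀ τ ∈ Ioo (-T) T, U (τ, x) 1 = y τ := by
    intro x T y h0 hy τ hτ
    obtain ⟨u, hu, hu1⟩ := sol_of_curve Fc x T y h0 hy τ hτ
    rw [← hu1, huniq (τ, x) u hu]
  refine ⟨fun p => U p 1, ?_, ?_, ?_⟩
  · have : ContDiff ℝ ∞ (fun u : CI E => u 1) :=
      ContinuousLinearMap.contDiff (E := CI E) (F := E)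
        (ContinuousMap.evalCLM ℝ (1 : unitInterval))
    exact this.comp hUs
  · intro x
    obtain ⟨y, h0, hy⟩ := exists_sol F K hK M hM x 1 (by positivity)
    exact (hΦ x 1 y h0 hy 0 (by simp)).trans h0
  · intro x τ
    obtain ⟨y, h0, hy⟩ := exists_sol F K hK M hM x (|τ| + 1) (by positivity)
    have hτ : τ ∈ Ioo (-(|τ| + 1)) (|τ| + 1) := abs_lt.1 (by linarith)
    simp only
    rw [hΦ x _ y h0 hy τ hτ]
    refine (hy τ hτ).congr_of_eventuallyEq ?_
    filter_upwards [Ioo_mem_nhds hτ.1 hτ.2] with s hs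
    exact hΦ x _ y h0 hy s hs

lemma flow_var {E : Type} [NormedAddCommGroup E] [NormedSpace ℝ E]
    (F : E → E) (hF : ContDiff ℝ ∞ F) (Φ : ℝ × E → E) (hΦ : ContDiff ℝ ∞ Φ)
    (hd : ∀ x τ, HasDerivAt (fun s => Φ (s, x)) (F (Φ (τ, x))) τ) (x w : E) (s : ℝ) :
    HasDerivAt (fun s => fderiv ℝ Φ (s, x) (0, w))
      (fderiv ℝ F (Φ (s, x)) (fderiv ℝ Φ (s, x) (0, w))) s := by
  have hΦd : ∀ p, HasFDerivAt Φ (fderiv ℝ Φ p) p := fun p =>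
    ((contDiff_infty_iff_fderiv.1 hΦ).1 p).hasFDerivAt
  have hΦ' : ContDiff ℝ ∞ (fderiv ℝ Φ) := (contDiff_infty_iff_fderiv.1 hΦ).2
  have hΦ'd : ∀ p, HasFDerivAt (fderiv ℝ Φ) (fderiv ℝ (fderiv ℝ Φ) p) p := fun p =>
    ((contDiff_infty_iff_fderiv.1 hΦ').1 p).hasFDerivAt
  have hline : ∀ s : ℝ, HasDerivAt (fun s : ℝ => (s, x)) ((1 : ℝ), (0 : E)) s := fun s =>
    (hasDerivAt_id s).prodMk (hasDerivAt_const s x)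
  have h10 : ∀ p : ℝ × E, fderiv ℝ Φ p (1, 0) = F (Φ p) := by
    rintro ⟨r, y⟩
    have h1 := (hΦd (r, y)).comp_hasDerivAt r
      ((hasDerivAt_id r).prodMk (hasDerivAt_const r y))
    exact h1.unique (hd y r)
  have h2 : HasDerivAt (fun s => fderiv ℝ Φ (s, x) (0, w))
      (fderiv ℝ (fderiv ℝ Φ) (s, x) (1, 0) (0, w)) s := by
    have h3 := (hΦ'd (s, x)).comp_hasDerivAt s (hline s)
    have h4 := h3.clm_apply (hasDerivAt_const s ((0 : ℝ), w))
    simpa using h4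
  have hsymm : IsSymmSndFDerivAt ℝ Φ (s, x) :=
    (hΦ.contDiffAt).isSymmSndFDerivAt (by
      simp only [minSmoothness_of_isRCLikeNormedField]; exact WithTop.coe_le_coe.2 (le_top : (2 : ℕ∞) ≤ ⊤))
  rw [hsymm.eq (1, 0) (0, w)] at h2
  have h5 : HasFDerivAt (fun p => fderiv ℝ Φ p (1, 0))
      ((fderiv ℝ (fderiv ℝ Φ) (s, x)).flip (1, 0)) (s, x) := by
    have := (hΦ'd (s, x)).clm_apply (hasFDerivAt_const ((1 : ℝ), (0 : E)) (s, x))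
    simpa using this
  have h6 : HasFDerivAt (fun p => fderiv ℝ Φ p (1, 0))
      (fderiv ℝ F (Φ (s, x)) ∘L fderiv ℝ Φ (s, x)) (s, x) := by
    have e : (fun p => fderiv ℝ Φ p (1, 0)) = F ∘ Φ := funext h10
    rw [e]
    exact ((contDiff_infty_iff_fderiv.1 hF).1 _).hasFDerivAt.comp (s, x) (hΦd _)
  have h7 := DFunLike.congr_fun (h5.unique h6) (0, w)
  simp only [ContinuousLinearMap.flip_apply, ContinuousLinearMap.comp_apply] at h7
  rwa [h7] at h2

lemma lin_unique {E : Type} [NormedAddCommGroup E] [NormedSpace ℝ E] (t : ℝ)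
    (A : ℝ → E →L[ℝ] E) (hA : ContinuousOn A (Icc 0 t)) (f g : ℝ → E)
    (hf : ∀ s ∈ Icc 0 t, HasDerivAt f (A s (f s)) s)
    (hg : ∀ s ∈ Icc 0 t, HasDerivAt g (A s (g s)) s) (h0 : f 0 = g 0) :
    EqOn f g (Icc 0 t) := by
  obtain ⟨K, hK⟩ := isCompact_Icc.exists_bound_of_continuousOn hA
  refine ODE_solution_unique_of_mem_Icc_right (v := fun s z => A s z) (s := fun _ => univ)
    (K := K.toNNReal) ?_ ?_ ?_ (fun _ _ => trivial) ?_ ?_ (fun _ _ => trivial) h0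
  · intro s hs
    have h1 : ‖A s‖₊ ≤ K.toNNReal := by
      rw [← norm_toNNReal]
      exact Real.toNNReal_le_toNNReal (hK s ⟨hs.1, hs.2.le⟩)
    exact ((A s).lipschitz.weaken h1).lipschitzOnWith
  · exact fun s hs => (hf s hs).continuousAt.continuousWithinAt
  · exact fun s hs => (hf s ⟨hs.1, hs.2.le⟩).hasDerivWithinAt
  · exact fun s hs => (hg s hs).continuousAt.continuousWithinAt
  · exact fun s hs => (hg s ⟨hs.1, hs.2.le⟩).hasDerivWithinAt

lemma clm_pi_sum {n : ℕ} (L : (Fin n → ℝ) →L[ℝ] ℝ) (x : Fin n → ℝ) :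
    L x = ∑ j, L (Pi.single j 1) * x j := by
  conv_lhs => rw [pi_eq_sum_univ' x]
  rw [map_sum]
  refine Finset.sum_congr rfl fun j _ => ?_
  rw [map_smul, smul_eq_mul, mul_comm]

lemma pd_contDiff {n : ℕ} {f : (Fin n → ℝ) → ℝ} (hf : ContDiff ℝ ∞ f) (j : Fin n) :
    ContDiff ℝ ∞ (pd f j) :=
  ((contDiff_infty_iff_fderiv.1 hf).2).clm_apply contDiff_const

/-- The phase space vector field. -/
def vf {n : ℕ} (B : Fin n → (Fin n → ℝ) → ℝ) (C : (Fin n → ℝ) → ℝ)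
    (z : (Fin n → ℝ) × (Fin n → ℝ)) : (Fin n → ℝ) × (Fin n → ℝ) :=
  (z.2, fun i => -(∑ j, (pd (B i) j z.1 - pd (B j) i z.1) * z.2 j) - pd C i z.1)

lemma vf_contDiff {n : ℕ} (B : Fin n → (Fin n → ℝ) → ℝ) (C : (Fin n → ℝ) → ℝ)
    (hB : ∀ i, ContDiff ℝ ∞ (B i)) (hC : ContDiff ℝ ∞ C) : ContDiff ℝ ∞ (vf B C) := by
  refine contDiff_snd.prodMk (contDiff_pi.2 fun i => ?_)
  refine (ContDiff.neg (ContDiff.sum fun j _ => ?_)).sub ((pd_contDiff hC i).comp contDiff_fst)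
  exact (((pd_contDiff (hB i) j).comp contDiff_fst).sub
    ((pd_contDiff (hB j) i).comp contDiff_fst)).mul
    ((contDiff_apply ℝ ℝ j).comp contDiff_snd)

lemma vf_fderiv {n : ℕ} (B : Fin n → (Fin n → ℝ) → ℝ) (C : (Fin n → ℝ) → ℝ)
    (hB : ∀ i, ContDiff ℝ ∞ (B i)) (hC : ContDiff ℝ ∞ C) (q v ξ η : Fin n → ℝ) :
    (fderiv ℝ (vf B C) (q, v) (ξ, η)).1 = η ∧
    ∀ i, (fderiv ℝ (vf B C) (q, v) (ξ, η)).2 i =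
      -((∑ j, (pd (B i) j q - pd (B j) i q) * η j)
      + ∑ j, ((∑ k, pd (fun q => pd (B i) k q - pd (B k) i q) j q * v k)
        + pd (pd C i) j q) * ξ j) := by
  have hd := ((contDiff_infty_iff_fderiv.1 (vf_contDiff B C hB hC)).1 (q, v)).hasFDerivAt
  constructor
  · have h1 := (hasFDerivAt_fst (𝕜 := ℝ)).comp (q, v) hd
    have h2 : HasFDerivAt (Prod.fst ∘ vf B C)
      (ContinuousLinearMap.snd ℝ (Fin n → ℝ) (Fin n → ℝ)) (q, v) := hasFDerivAt_snd
    exact DFunLike.congr_fun (h1.unique h2) (ξ, η)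
  · intro i
    have h0 := (hasFDerivAt_snd (𝕜 := ℝ)).comp (q, v) hd
    have h1 := (hasFDerivAt_pi'.1 h0) i
    have hΩ : ∀ j, HasFDerivAt (fun q => pd (B i) j q - pd (B j) i q)
        (fderiv ℝ (fun q => pd (B i) j q - pd (B j) i q) q) q := fun j =>
      ((contDiff_infty_iff_fderiv.1 ((pd_contDiff (hB i) j).sub
        (pd_contDiff (hB j) i))).1 q).hasFDerivAt
    have hC' : HasFDerivAt (pd C i) (fderiv ℝ (pd C i) q) q :=
      ((contDiff_infty_iff_fderiv.1 (pd_contDiff hC i)).1 q).hasFDerivAt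
    have hfst : HasFDerivAt (Prod.fst : (Fin n → ℝ) × (Fin n → ℝ) → _)
      (ContinuousLinearMap.fst ℝ (Fin n → ℝ) (Fin n → ℝ)) (q, v) := hasFDerivAt_fst
    have hs : ∀ j, HasFDerivAt (fun z : (Fin n → ℝ) × (Fin n → ℝ) => z.2 j)
      ((ContinuousLinearMap.proj j : (Fin n → ℝ) →L[ℝ] ℝ) ∘L
        ContinuousLinearMap.snd ℝ (Fin n → ℝ) (Fin n → ℝ)) (q, v) := fun j =>
      ((ContinuousLinearMap.proj j : (Fin n → ℝ) →L[ℝ] ℝ) ∘L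
        ContinuousLinearMap.snd ℝ (Fin n → ℝ) (Fin n → ℝ)).hasFDerivAt
    have h2 := (HasFDerivAt.fun_sum (u := Finset.univ)
      (fun j _ => ((hΩ j).comp (q, v) hfst).mul (hs j))).neg.sub (hC'.comp (q, v) hfst)
    have h3 := DFunLike.congr_fun (h1.unique h2) (ξ, η)
    refine Eq.trans h3 ?_
    simp only [sub_apply, neg_apply, sum_apply, add_apply, smul_apply,
      ContinuousLinearMap.comp_apply, ContinuousLinearMap.coe_fst', ContinuousLinearMap.coe_snd',
      ContinuousLinearMap.proj_apply, Function.comp_apply, smul_eq_mul]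
    rw [clm_pi_sum (fderiv ℝ (pd C i) q) ξ]
    have e : ∀ j, fderiv ℝ (fun q => pd (B i) j q - pd (B j) i q) q ξ =
      ∑ k, pd (fun q => pd (B i) j q - pd (B j) i q) k q * ξ k := fun j => clm_pi_sum _ _
    simp only [e, Finset.sum_add_distrib, add_mul, Finset.sum_mul, Finset.mul_sum]
    rw [Finset.sum_comm (f := fun j k => v j * _)]
    have e2 : ∀ j k, v k * (pd (fun q => pd (B i) k q - pd (B k) i q) j q * ξ j) =
      pd (fun q => pd (B i) k q - pd (B k) i q) j q * v k * ξ j := fun j k => by ring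
    simp only [e2]
    simp only [pd]
    ring

lemma vf_curve_of_classical {n : ℕ} (B : Fin n → (Fin n → ℝ) → ℝ) (C : (Fin n → ℝ) → ℝ)
    (γ : ℝ → Fin n → ℝ) (hγ : ContDiff ℝ ∞ γ) (t : ℝ) (hcl : IsClassical B C t γ)
    (s : ℝ) (hs : s ∈ Icc 0 t) :
    HasDerivAt (fun s => (γ s, deriv γ s)) (vf B C (γ s, deriv γ s)) s := by
  have h1 := contDiff_infty_iff_deriv.1 hγ
  have h2 := contDiff_infty_iff_deriv.1 h1.2
  have h3 : deriv (deriv γ) s = (vf B C (γ s, deriv γ s)).2 := by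
    ext i
    have := hcl s hs i
    simp only [vf]
    linarith
  have h4 := (h1.1 s).hasDerivAt.prodMk (h2.1 s).hasDerivAt
  rw [h3] at h4
  exact h4

lemma jacobi_eq {n : ℕ} (B : Fin n → (Fin n → ℝ) → ℝ) (C : (Fin n → ℝ) → ℝ)
    (hB : ∀ i, ContDiff ℝ ∞ (B i)) (hC : ContDiff ℝ ∞ C) (γ ξ : ℝ → Fin n → ℝ) (s : ℝ) (i) :
    Jacobi B C γ ξ s i = deriv (deriv ξ) s i -
      (fderiv ℝ (vf B C) (γ s, deriv γ s) (ξ s, deriv ξ s)).2 i := by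
  rw [(vf_fderiv B C hB hC _ _ _ _).2 i, Jacobi]
  ring

lemma nondeg_iff {n : ℕ} (B : Fin n → (Fin n → ℝ) → ℝ) (C : (Fin n → ℝ) → ℝ)
    (hB : ∀ i, ContDiff ℝ ∞ (B i)) (hC : ContDiff ℝ ∞ C) (t : ℝ) (ht : 0 < t)
    (γ : ℝ → Fin n → ℝ) (hγ : ContDiff ℝ ∞ γ)
    (J : (Fin n → ℝ) → ℝ → (Fin n → ℝ) × (Fin n → ℝ)) (hJ : ∀ w, ContDiff ℝ ∞ (J w))
    (hJ0 : ∀ w, J w 0 = (0, w)) (V : Set ℝ) (hV : IsOpen V) (hVI : Icc 0 t ⊆ V)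
    (hJd : ∀ w, ∀ s ∈ V, HasDerivAt (J w)
      (fderiv ℝ (vf B C) (γ s, deriv γ s) (J w s)) s) :
    Nondegenerate B C t γ ↔ ∀ w, (J w t).1 = 0 → w = 0 := by
  have ht0 : (0:ℝ) ∈ Icc 0 t := ⟨le_rfl, ht.le⟩
  have htt : t ∈ Icc 0 t := ⟨ht.le, le_rfl⟩
  constructor
  · intro hnd w hw
    have hfst : ∀ s ∈ V, HasDerivAt (fun s => (J w s).1) (J w s).2 s := by
      intro s hs
      have h1 := (hasFDerivAt_fst (𝕜 := ℝ)).comp_hasDerivAt s (hJd w s hs)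
      have h2 := (vf_fderiv B C hB hC (γ s) (deriv γ s) (J w s).1 (J w s).2).1
      have h3 : HasDerivAt (fun s => (J w s).1)
        (fderiv ℝ (vf B C) (γ s, deriv γ s) ((J w s).1, (J w s).2)).1 s := h1
      rwa [h2] at h3
    have hz := hnd (fun s => (J w s).1) (contDiff_fst.comp (hJ w)) (by simp [hJ0]) hw (by
      intro s hs i
      rw [jacobi_eq B C hB hC]
      have hsV := hVI hs
      have e1 : deriv (fun s => (J w s).1) =ᶠ[𝓝 s] fun s => (J w s).2 := by
        filter_upwards [hV.mem_nhds hsV] with r hr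
        exact (hfst r hr).deriv
      have h1 : HasDerivAt (fun s => (J w s).2)
        (fderiv ℝ (vf B C) (γ s, deriv γ s) (J w s)).2 s := by
        have h5 := (hasFDerivAt_snd (𝕜 := ℝ)).comp_hasDerivAt s (hJd w s hsV)
        exact h5
      rw [e1.deriv_eq, h1.deriv, (hfst s hsV).deriv, sub_self])
    have h1 := (hfst 0 (hVI ht0)).hasDerivWithinAt (s := Icc 0 t)
    have h2 : HasDerivWithinAt (fun s => (J w s).1) 0 (Icc 0 t) 0 :=
      (hasDerivWithinAt_const (0:ℝ) (Icc 0 t) (0 : Fin n → ℝ)).congr hz (hz 0 ht0)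
    have h3 := (uniqueDiffOn_Icc ht 0 ht0).eq_deriv _ h1 h2
    rw [hJ0] at h3
    exact h3
  · intro hinj ξ hξ h0 hξt hjac
    have d1 := contDiff_infty_iff_deriv.1 hξ
    have d2 := contDiff_infty_iff_deriv.1 d1.2
    have g1 := contDiff_infty_iff_deriv.1 hγ
    have hA : Continuous fun s => fderiv ℝ (vf B C) (γ s, deriv γ s) :=
      (contDiff_infty_iff_fderiv.1 (vf_contDiff B C hB hC)).2.continuous.comp
        (hγ.continuous.prodMk g1.2.continuous)
    have hξd : ∀ s ∈ Icc 0 t, HasDerivAt (fun s => (ξ s, deriv ξ s))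
        (fderiv ℝ (vf B C) (γ s, deriv γ s) (ξ s, deriv ξ s)) s := by
      intro s hs
      have h4 := (d1.1 s).hasDerivAt.prodMk (d2.1 s).hasDerivAt
      convert h4 using 1
      refine Prod.ext (vf_fderiv B C hB hC _ _ _ _).1 ?_
      ext i
      have := hjac s hs i
      rw [jacobi_eq B C hB hC] at this
      simp only
      linarith
    have heq := lin_unique t _ hA.continuousOn _ (J (deriv ξ 0)) hξd
      (fun s hs => hJd _ s (hVI hs)) (by simp [hJ0, h0])
    have hw : deriv ξ 0 = 0 := by
      apply hinj
      rw [← heq htt]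
      exact hξt
    have hzero := lin_unique t _ hA.continuousOn _ (fun _ => 0) hξd
      (fun s hs => by simpa using hasDerivAt_const s (0 : (Fin n → ℝ) × (Fin n → ℝ)))
      (by simp [h0, hw])
    intro s hs
    exact congrArg Prod.fst (hzero hs)

lemma cutoff {E : Type} [NormedAddCommGroup E] [NormedSpace ℝ E] [FiniteDimensional ℝ E]
    (X : E → E) (hX : ContDiff ℝ ∞ X) (R : ℝ) (hR : 0 < R) :
    ∃ F : E → E, ContDiff ℝ ∞ F ∧ (∃ K : NNReal, LipschitzWith K F) ∧
      (∃ M : NNReal, ∀ x, ‖F x‖ ≤ M) ∧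
      ∀ x ∈ Metric.ball (0:E) R, F =ᶠ[𝓝 x] X := by
  let χ : ContDiffBump (0:E) := ⟨R, R + 1, hR, by linarith⟩
  have hs : ContDiff ℝ ∞ fun x => χ x • X x := χ.contDiff.smul hX
  have hc : HasCompactSupport fun x => χ x • X x := χ.hasCompactSupport.smul_right
  refine ⟨fun x => χ x • X x, hs, ?_, ?_, ?_⟩
  · exact hs.lipschitzWith_of_hasCompactSupport hc (by simp)
  · obtain ⟨M, hM⟩ := hc.exists_bound_of_continuous hs.continuous
    exact ⟨M.toNNReal, fun x => (hM x).trans (Real.le_coe_toNNReal M)⟩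
  · intro x hx
    filter_upwards [χ.eventuallyEq_one_of_mem_ball hx] with y hy
    simp [hy]

/-- Lemma 2.1.4. A nondegenerate classical path extends to a smooth
family of nondegenerate classical paths with boundary values in a neighborhood of
`(γ 0, γ t)`. -/
theorem statement0 {n : ℕ} (hn : 1 ≤ n)
    (B : Fin n → (Fin n → ℝ) → ℝ) (C : (Fin n → ℝ) → ℝ)
    (hB : ∀ i, ContDiff ℝ (⊤ : ℕ∞) (B i)) (hC : ContDiff ℝ (⊤ : ℕ∞) C)
    (t : ℝ) (ht : 0 < t) (γ : ℝ → Fin n → ℝ) (hγ : ContDiff ℝ (⊤ : ℕ∞) γ)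
    (hcl : IsClassical B C t γ) (hnd : Nondegenerate B C t γ) :
    ∃ O : Set ((Fin n → ℝ) × (Fin n → ℝ)), IsOpen O ∧ (γ 0, γ t) ∈ O ∧
      ∃ ghat : ℝ → (Fin n → ℝ) → (Fin n → ℝ) → Fin n → ℝ,
        ContDiffOn ℝ (⊤ : ℕ∞)
          (fun p : ℝ × (Fin n → ℝ) × (Fin n → ℝ) => ghat p.1 p.2.1 p.2.2)
          (Icc 0 t ×ˢ O) ∧
        (∀ q ∈ O,
          ContDiff ℝ (⊤ : ℕ∞) (fun τ => ghat τ q.1 q.2) ∧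
          IsClassical B C t (fun τ => ghat τ q.1 q.2) ∧
          Nondegenerate B C t (fun τ => ghat τ q.1 q.2) ∧
          ghat 0 q.1 q.2 = q.1 ∧ ghat t q.1 q.2 = q.2) ∧
        (∀ τ ∈ Icc (0:ℝ) t, ghat τ (γ 0) (γ t) = γ τ) := by
  classical
  have hX := vf_contDiff B C hB hC
  have g1 := contDiff_infty_iff_deriv.1 hγ
  have hzs : Continuous fun s => (γ s, deriv γ s) := hγ.continuous.prodMk g1.2.continuous
  obtain ⟨R0, hR0⟩ := (isCompact_Icc (a := (0:ℝ)) (b := t)).exists_bound_of_continuousOn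
    hzs.continuousOn
  have hR : 0 < |R0| + 1 := by positivity
  obtain ⟨F, hF, ⟨K, hK⟩, ⟨M, hM⟩, hFX⟩ := cutoff (vf B C) hX (|R0| + 1) hR
  set R := |R0| + 1 with hRdef
  obtain ⟨Φ, hΦ, hΦ0, hΦd⟩ := exists_flow F hF K hK M hM
  have ht0 : (0:ℝ) ∈ Icc 0 t := ⟨le_rfl, ht.le⟩
  have htt : t ∈ Icc 0 t := ⟨ht.le, le_rfl⟩
  have hzball : ∀ s ∈ Icc 0 t, (γ s, deriv γ s) ∈ Metric.ball 0 R := by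
    intro s hs
    rw [mem_ball_zero_iff]
    have := hR0 s hs
    have := le_abs_self R0
    linarith
  -- the base path
  set x0 : (Fin n → ℝ) × (Fin n → ℝ) := (γ 0, deriv γ 0) with hx0
  have hbase : ∀ s ∈ Icc 0 t, Φ (s, x0) = (γ s, deriv γ s) := by
    have hz : ∀ s ∈ Icc 0 t, HasDerivAt (fun s => (γ s, deriv γ s)) (F (γ s, deriv γ s)) s := by
      intro s hs
      rw [(hFX _ (hzball s hs)).eq_of_nhds]
      exact vf_curve_of_classical B C γ hγ t hcl s hs
    exact ODE_solution_unique (v := fun _ => F) (fun _ => hK)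
      (fun s _ => (hΦd x0 s).continuousAt.continuousWithinAt)
      (fun s _ => (hΦd x0 s).hasDerivWithinAt) hzs.continuousOn
      (fun s hs => (hz s ⟨hs.1, hs.2.le⟩).hasDerivWithinAt) (hΦ0 x0)
  -- good initial conditions
  let W : Set ((Fin n → ℝ) × (Fin n → ℝ)) := {x | ∀ s ∈ Icc 0 t, Φ (s, x) ∈ Metric.ball 0 R}
  have hW : IsOpen W := by
    rw [isOpen_iff_mem_nhds]
    intro x hx
    refine isCompact_Icc.eventually_forall_of_forall_eventually (fun s hs => ?_)
    have hc : Continuous fun z : ((Fin n → ℝ) × (Fin n → ℝ)) × ℝ => Φ (z.2, z.1) :=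
      hΦ.continuous.comp (continuous_snd.prodMk continuous_fst)
    exact hc.continuousAt.eventually (Metric.isOpen_ball.mem_nhds (hx s hs))
  have hx0W : x0 ∈ W := fun s hs => by rw [hbase s hs]; exact hzball s hs
  have hVo : ∀ x, IsOpen {s : ℝ | Φ (s, x) ∈ Metric.ball 0 R} := fun x =>
    Metric.isOpen_ball.preimage (hΦ.continuous.comp (by fun_prop : Continuous fun s : ℝ => (s, x)))
  have hΦs : ∀ x, ContDiff ℝ ∞ fun s : ℝ => Φ (s, x) := fun x =>
    hΦ.comp (contDiff_id.prodMk contDiff_const)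
  have hd : ∀ x s, Φ (s, x) ∈ Metric.ball 0 R →
      HasDerivAt (fun s => Φ (s, x)) (vf B C (Φ (s, x))) s := by
    intro x s hs
    rw [← (hFX _ hs).eq_of_nhds]
    exact hΦd x s
  have hd1 : ∀ x s, Φ (s, x) ∈ Metric.ball 0 R →
      deriv (fun s => (Φ (s, x)).1) s = (Φ (s, x)).2 := by
    intro x s hs
    have h := (hasFDerivAt_fst (𝕜 := ℝ)).comp_hasDerivAt s (hd x s hs)
    exact HasDerivAt.deriv h
  have hd2 : ∀ x s, Φ (s, x) ∈ Metric.ball 0 R →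
      deriv (deriv (fun s => (Φ (s, x)).1)) s = (vf B C (Φ (s, x))).2 := by
    intro x s hs
    have e1 : deriv (fun s => (Φ (s, x)).1) =ᶠ[𝓝 s] fun s => (Φ (s, x)).2 := by
      filter_upwards [(hVo x).mem_nhds hs] with r hr
      exact hd1 x r hr
    rw [e1.deriv_eq]
    have h := (hasFDerivAt_snd (𝕜 := ℝ)).comp_hasDerivAt s (hd x s hs)
    exact HasDerivAt.deriv h
  have hclass : ∀ x ∈ W, IsClassical B C t fun s => (Φ (s, x)).1 := by
    intro x hx s hs i
    rw [hd2 x s (hx s hs), hd1 x s (hx s hs)]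
    simp only [vf]
    ring
  -- Jacobi fields
  have hnondeg : ∀ x ∈ W, Nondegenerate B C t (fun s => (Φ (s, x)).1) ↔
      ∀ w, (fderiv ℝ Φ (t, x) (0, (0, w))).1 = 0 → w = 0 := by
    intro x hx
    refine nondeg_iff B C hB hC t ht (fun s => (Φ (s, x)).1) (contDiff_fst.comp (hΦs x))
      (fun w s => fderiv ℝ Φ (s, x) (0, (0, w))) ?_ ?_ _ (hVo x) hx ?_
    · intro w
      exact ((contDiff_infty_iff_fderiv.1 hΦ).2.comp
        (contDiff_id.prodMk contDiff_const)).clm_apply contDiff_const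
    · intro w
      have h1 : HasFDerivAt (fun y => Φ ((0:ℝ), y)) (fderiv ℝ Φ (0, x) ∘L
          ContinuousLinearMap.inr ℝ ℝ ((Fin n → ℝ) × (Fin n → ℝ))) x :=
        HasFDerivAt.comp x (f := fun y => ((0:ℝ), y)) (g := Φ)
          ((contDiff_infty_iff_fderiv.1 hΦ).1 (0, x)).hasFDerivAt
          (hasFDerivAt_prodMk_right (0:ℝ) x)
      have h2 : (fun y => Φ ((0:ℝ), y)) = id := funext hΦ0
      rw [h2] at h1
      exact DFunLike.congr_fun (h1.unique (hasFDerivAt_id x)) (0, w)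
    · intro w s hs
      have h1 := flow_var F hF Φ hΦ hΦd x (0, w) s
      rw [(hFX _ hs).fderiv_eq] at h1
      have h2 := hd1 x s hs
      rw [h2]
      exact h1
  -- the shooting map
  let G : (Fin n → ℝ) × (Fin n → ℝ) → (Fin n → ℝ) × (Fin n → ℝ) := fun x => (x.1, (Φ (t, x)).1)
  have hG : ContDiff ℝ ∞ G := contDiff_fst.prodMk
    (contDiff_fst.comp (hΦ.comp (contDiff_const.prodMk contDiff_id)))
  have hGd : ∀ x, HasFDerivAt G (fderiv ℝ G x) x := fun x =>
    ((contDiff_infty_iff_fderiv.1 hG).1 x).hasFDerivAt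
  have hGf : ∀ x a, fderiv ℝ G x a = (a.1, (fderiv ℝ Φ (t, x) (0, a)).1) := by
    intro x a
    have h1 : HasFDerivAt (fun y => Φ (t, y)) (fderiv ℝ Φ (t, x) ∘L
          ContinuousLinearMap.inr ℝ ℝ ((Fin n → ℝ) × (Fin n → ℝ))) x :=
        HasFDerivAt.comp x (f := fun y => (t, y)) (g := Φ)
          ((contDiff_infty_iff_fderiv.1 hΦ).1 (t, x)).hasFDerivAt
          (hasFDerivAt_prodMk_right t x)
    have h2 := (hasFDerivAt_fst (𝕜 := ℝ) (p := x)).prodMk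
      ((hasFDerivAt_fst (𝕜 := ℝ) (p := Φ (t, x))).comp x h1)
    exact DFunLike.congr_fun ((hGd x).unique h2) a
  have hunit : ∀ x, IsUnit (fderiv ℝ G x) ↔
      ∀ w, (fderiv ℝ Φ (t, x) (0, (0, w))).1 = 0 → w = 0 := by
    intro x
    constructor
    · rintro ⟨u, hu⟩ w hw
      have h1 : fderiv ℝ G x (0, w) = 0 := by rw [hGf, hw]; rfl
      have h2 : (u⁻¹.1 * u.1) (0, w) = 0 := by
        rw [mul_apply_eq_comp, hu, h1, map_zero]
      rw [u.inv_mul] at h2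
      exact congrArg Prod.snd h2
    · intro h
      have hinj : Function.Injective (fderiv ℝ G x) := by
        rw [injective_iff_map_eq_zero]
        rintro ⟨a, w⟩ haw
        rw [hGf] at haw
        obtain ⟨h1, h2⟩ := Prod.mk.inj haw
        simp only at h1
        subst h1
        rw [h w h2]; rfl
      let eL := (LinearEquiv.ofInjectiveEndo (fderiv ℝ G x).toLinearMap
        hinj).toContinuousLinearEquiv
      exact ⟨(ContinuousLinearEquiv.unitsEquiv ℝ _).symm eL, by ext <;> rfl⟩
  let N : Set ((Fin n → ℝ) × (Fin n → ℝ)) := W ∩ {x | IsUnit (fderiv ℝ G x)}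
  have hN : IsOpen N :=
    hW.inter (Units.isOpen.preimage (contDiff_infty_iff_fderiv.1 hG).2.continuous)
  have hx0N : x0 ∈ N := by
    refine ⟨hx0W, (hunit x0).2 ((hnondeg x0 hx0W).1 ?_)⟩
    intro ξ h1 h2 h3 h4
    refine hnd ξ h1 h2 h3 fun s hs i => ?_
    have := h4 s hs i
    rw [jacobi_eq B C hB hC] at this ⊢
    simp only [hd1 x0 s (hx0W s hs), hbase s hs] at this
    exact this
  have heq : ∀ x ∈ N, ∃ A : ((Fin n → ℝ) × (Fin n → ℝ)) ≃L[ℝ] ((Fin n → ℝ) × (Fin n → ℝ)),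
      (A : ((Fin n → ℝ) × (Fin n → ℝ)) →L[ℝ] ((Fin n → ℝ) × (Fin n → ℝ))) = fderiv ℝ G x := by
    rintro x ⟨-, u, hu⟩
    exact ⟨ContinuousLinearEquiv.unitsEquiv ℝ _ u, hu⟩
  obtain ⟨A0, hA0⟩ := heq x0 hx0N
  have hA0' : HasFDerivAt G (A0 : _ →L[ℝ] _) x0 := hA0 ▸ hGd x0
  let e := hG.contDiffAt.toOpenPartialHomeomorph G hA0' (by simp)
  have hes : x0 ∈ e.source := hG.contDiffAt.mem_toOpenPartialHomeomorph_source hA0' (by simp)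
  have heG : ∀ x, e x = G x := fun x => rfl
  have hGx0 : G x0 = (γ 0, γ t) := by
    show (x0.1, (Φ (t, x0)).1) = (γ 0, γ t)
    rw [hbase t htt]
  have hsymm0 : e.symm (γ 0, γ t) = x0 := by
    rw [← hGx0, ← heG, e.left_inv hes]
  have hO : IsOpen (e.target ∩ e.symm ⁻¹' N) := e.isOpen_inter_preimage_symm hN
  refine ⟨e.target ∩ e.symm ⁻¹' N, hO, ⟨?_, ?_⟩,
    fun s q0 q1 => (Φ (s, e.symm (q0, q1))).1, ?_, ?_, ?_⟩
  · rw [← hGx0, ← heG]; exact e.map_source hes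
  · rw [mem_preimage, hsymm0]; exact hx0N
  · rintro ⟨s, q⟩ ⟨-, hq⟩
    obtain ⟨A, hA⟩ := heq _ hq.2
    have hsm : ContDiffAt ℝ ∞ e.symm q :=
      e.contDiffAt_symm hq.1 (f₀' := A) (hA ▸ hGd _) hG.contDiffAt
    have h1 : ContDiffAt ℝ ∞ (fun p : ℝ × (Fin n → ℝ) × (Fin n → ℝ) => (p.1, e.symm p.2)) (s, q) :=
      contDiffAt_fst.prodMk (ContDiffAt.comp (s, q) (f := Prod.snd) (g := e.symm) hsm contDiffAt_snd)
    exact ((contDiff_fst.comp hΦ).contDiffAt.comp (s, q) h1).contDiffWithinAt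
  · rintro ⟨q0, q1⟩ hq
    have hGe : G (e.symm (q0, q1)) = (q0, q1) := e.right_inv hq.1
    refine ⟨contDiff_fst.comp (hΦs _), hclass _ hq.2.1,
      (hnondeg _ hq.2.1).2 ((hunit _).1 hq.2.2), ?_, ?_⟩
    · show (Φ (0, e.symm (q0, q1))).1 = q0
      rw [hΦ0]; exact congrArg Prod.fst hGe
    · exact congrArg Prod.snd hGe
  · intro s hs
    show (Φ (s, e.symm (γ 0, γ t))).1 = γ s
    rw [hsymm0, hbase s hs]
end
end

section
/- Let γ be a smooth family of nondegenerate classical paths over an open set O ⊆ ℝ_{>0} × ℝ^n × ℝ^n, with Hamilton function S_γ and Green's kernel G_γ. Fix (t,q_0,q_1) ∈ O and write G = G_γ(·,·) at this parameter value. Then: (i) G^{ij}(ς,τ) = 0 whenever ς ∈ {0,t} or τ ∈ {0,t}; (ii) for every smooth based loop ξ of duration t and every ς ∈ [0,t], Σ_j ∫_0^t G^{ij}(ς,τ) D_γ[ξ]^j(τ) dτ = −ξ^i(ς). That is, −G_γ is a Green's function for D_γ with Dirichlet boundary conditions: D_γ acting in the variables (j,τ) of G_γ^{ij}(ς,τ)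 yields −δ^i_j δ(τ−ς). -/
open MeasureTheory Set
open scoped BigOperators

noncomputable section

section generic

set_option linter.unusedSectionVars false

variable {Q E : Type*} [NormedAddCommGroup Q] [NormedSpace ℝ Q]
  [NormedAddCommGroup E] [NormedSpace ℝ E]

/-- The domain of a family of paths at fixed duration. -/
abbrev slab (t : ℝ) (U : Set Q) : Set (ℝ × Q) := Icc (0:ℝ) t ×ˢ U

/-- Time derivative on the slab. -/
def dT (t : ℝ) (U : Set Q) (h : ℝ × Q → E) (p : ℝ × Q) : E :=
  fderivWithin ℝ h (slab t U) p (1, 0)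

/-- Parameter derivative on the slab. -/
def dQ (t : ℝ) (U : Set Q) (h : ℝ × Q → E) (w : Q) (p : ℝ × Q) : E :=
  fderivWithin ℝ h (slab t U) p (0, w)

lemma slab_unique {t : ℝ} (ht : 0 < t) {U : Set Q} (hU : IsOpen U) :
    UniqueDiffOn ℝ (slab t U) :=
  (uniqueDiffOn_Icc ht).prod hU.uniqueDiffOn

lemma slab_contDiff_dT {t : ℝ} (ht : 0 < t) {U : Set Q} (hU : IsOpen U) {h : ℝ × Q → E}
    (hh : ContDiffOn ℝ (⊤ : ℕ∞) h (slab t U)) :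
    ContDiffOn ℝ (⊤ : ℕ∞) (dT t U h) (slab t U) :=
  (hh.fderivWithin (slab_unique ht hU) (m := (⊤ : ℕ∞)) (by simp)).clm_apply contDiffOn_const

lemma slab_contDiff_dQ {t : ℝ} (ht : 0 < t) {U : Set Q} (hU : IsOpen U) {h : ℝ × Q → E}
    (hh : ContDiffOn ℝ (⊤ : ℕ∞) h (slab t U)) (w : Q) :
    ContDiffOn ℝ (⊤ : ℕ∞) (dQ t U h w) (slab t U) :=
  (hh.fderivWithin (slab_unique ht hU) (m := (⊤ : ℕ∞)) (by simp)).clm_apply contDiffOn_const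

lemma slab_hasFDeriv {t : ℝ} {U : Set Q} {h : ℝ × Q → E}
    (hh : ContDiffOn ℝ (⊤ : ℕ∞) h (slab t U)) {p : ℝ × Q} (hp : p ∈ slab t U) :
    HasFDerivWithinAt h (fderivWithin ℝ h (slab t U) p) (slab t U) p :=
  ((hh.differentiableOn (by simp)) p hp).hasFDerivWithinAt

lemma slab_hasDerivWithin_T {t : ℝ} {U : Set Q} {h : ℝ × Q → E}
    (hh : ContDiffOn ℝ (⊤ : ℕ∞) h (slab t U)) {τ : ℝ} {q : Q} (hτ : τ ∈ Icc 0 t) (hq : q ∈ U) :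
    HasDerivWithinAt (fun s => h (s, q)) (dT t U h (τ, q)) (Icc 0 t) τ := by
  have h1 := slab_hasFDeriv hh (p := (τ, q)) ⟨hτ, hq⟩
  have h2 : HasDerivWithinAt (fun s : ℝ => (s, q)) ((1:ℝ), (0:Q)) (Icc 0 t) τ :=
    (hasDerivWithinAt_id τ _).prodMk (hasDerivWithinAt_const τ _ q)
  have h3 : MapsTo (fun s : ℝ => (s, q)) (Icc 0 t) (slab t U) := fun s hs => ⟨hs, hq⟩
  exact h1.comp_hasDerivWithinAt τ h2 h3

lemma slab_hasFDeriv_Q {t : ℝ} {U : Set Q} (hU : IsOpen U) {h : ℝ × Q → E}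
    (hh : ContDiffOn ℝ (⊤ : ℕ∞) h (slab t U)) {τ : ℝ} {q : Q} (hτ : τ ∈ Icc 0 t) (hq : q ∈ U) :
    HasFDerivAt (fun x => h (τ, x))
      ((fderivWithin ℝ h (slab t U) (τ, q)).comp (ContinuousLinearMap.inr ℝ ℝ Q)) q := by
  have h1 := slab_hasFDeriv hh (p := (τ, q)) ⟨hτ, hq⟩
  have h2 : HasFDerivWithinAt (fun x : Q => (τ, x)) (ContinuousLinearMap.inr ℝ ℝ Q) U q :=
    (hasFDerivAt_prodMk_right τ q).hasFDerivWithinAt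
  exact (h1.comp q h2 (fun s hs => ⟨hτ, hs⟩)).hasFDerivAt (hU.mem_nhds hq)

lemma slab_hasDeriv_line {t : ℝ} {U : Set Q} (hU : IsOpen U) {h : ℝ × Q → E}
    (hh : ContDiffOn ℝ (⊤ : ℕ∞) h (slab t U)) {τ : ℝ} {q : Q} (hτ : τ ∈ Icc 0 t) (hq : q ∈ U)
    (w : Q) :
    HasDerivAt (fun s : ℝ => h (τ, q + s • w)) (dQ t U h w (τ, q)) 0 := by
  have h1 := slab_hasFDeriv_Q hU hh hτ hq
  have h2 : HasDerivAt (fun s : ℝ => q + s • w) w 0 := by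
    simpa using ((hasDerivAt_id (0:ℝ)).smul_const w).const_add q
  have h1' : HasFDerivAt (fun x => h (τ, x))
      ((fderivWithin ℝ h (slab t U) (τ, q)).comp (ContinuousLinearMap.inr ℝ ℝ Q))
      (q + (0:ℝ) • w) := by simpa using h1
  have h3 := h1'.comp_hasDerivAt (0:ℝ) h2
  simp only [ContinuousLinearMap.comp_apply, ContinuousLinearMap.inr_apply] at h3
  exact h3

lemma slab_cont {t : ℝ} {U : Set Q} {h : ℝ × Q → E}
    (hh : ContinuousOn h (slab t U)) {q : Q} (hq : q ∈ U) :
    ContinuousOn (fun s => h (s, q)) (Icc 0 t) :=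
  hh.comp (by fun_prop) (fun s hs => ⟨hs, hq⟩)

/-- Mixed partial derivatives commute in the interior. -/
lemma slab_swap {t : ℝ} {U : Set Q} (hU : IsOpen U) {h : ℝ × Q → E}
    (hh : ContDiffOn ℝ (⊤ : ℕ∞) h (slab t U)) {τ : ℝ} {q : Q} (hτ : τ ∈ Ioo 0 t) (hq : q ∈ U)
    (w : Q) :
    HasDerivAt (fun s => dQ t U h w (s, q)) (dQ t U (dT t U h) w (τ, q)) τ := by
  have hI : IsOpen (Ioo (0:ℝ) t ×ˢ U) := isOpen_Ioo.prod hU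
  have hnb : ∀ p ∈ Ioo (0:ℝ) t ×ˢ U, slab t U ∈ nhds p := fun p hp =>
    Filter.mem_of_superset (hI.mem_nhds hp) (prod_mono Ioo_subset_Icc_self subset_rfl)
  have hp : (τ, q) ∈ Ioo (0:ℝ) t ×ˢ U := ⟨hτ, hq⟩
  have hca : ContDiffAt ℝ (⊤ : ℕ∞) h (τ, q) :=
    hh.contDiffAt (hnb _ hp)
  have hd : DifferentiableAt ℝ (fderiv ℝ h) (τ, q) :=
    (hca.fderiv_right (m := 1) (by norm_cast)).differentiableAt (by simp)
  have hsym : IsSymmSndFDerivAt ℝ h (τ, q) := hca.isSymmSndFDerivAt (by simp; exact WithTop.coe_le_coe.2 (le_top (a := (2:ℕ∞))))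
  have e1 : (fun s => dQ t U h w (s, q)) =ᶠ[nhds τ] fun s => fderiv ℝ h (s, q) (0, w) := by
    filter_upwards [isOpen_Ioo.mem_nhds hτ] with s hs
    simp only [dQ]
    rw [fderivWithin_of_mem_nhds (hnb _ ⟨hs, hq⟩)]
  have e2 : dT t U h =ᶠ[nhds (τ, q)] fun p => fderiv ℝ h p (1, 0) := by
    filter_upwards [hI.mem_nhds hp] with s hs
    simp only [dT]
    rw [fderivWithin_of_mem_nhds (hnb _ hs)]
  have e3 : dQ t U (dT t U h) w (τ, q) = fderiv ℝ (fderiv ℝ h) (τ, q) (0, w) (1, 0) := by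
    simp only [dQ]
    rw [fderivWithin_of_mem_nhds (hnb _ hp), e2.fderiv_eq]
    rw [fderiv_clm_apply hd (differentiableAt_const _)]
    simp
  rw [e3, hsym.eq (0, w) (1, 0)]
  refine HasDerivAt.congr_of_eventuallyEq ?_ e1
  have h2 : HasDerivAt (fun s : ℝ => (s, q)) ((1:ℝ), (0:Q)) τ :=
    (hasDerivAt_id τ).prodMk (hasDerivAt_const τ q)
  have h3 := hd.hasFDerivAt.comp_hasDerivAt τ h2
  simpa using h3.clm_apply (hasDerivAt_const τ ((0:ℝ), w))

/-- Differentiation under the integral sign. -/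
lemma slab_integral [FiniteDimensional ℝ Q] [CompleteSpace E] {t : ℝ} (ht : 0 < t) {U : Set Q} (hU : IsOpen U)
    {h : ℝ × Q → E} (hh : ContDiffOn ℝ (⊤ : ℕ∞) h (slab t U)) {q : Q} (hq : q ∈ U) :
    ∃ L : Q →L[ℝ] E, HasFDerivAt (fun x => ∫ τ in (0:ℝ)..t, h (τ, x)) L q ∧
      ∀ w, L w = ∫ τ in (0:ℝ)..t, dQ t U h w (τ, q) := by
  have : ProperSpace Q := FiniteDimensional.proper ℝ Q
  have hc1 : ContinuousOn (fderivWithin ℝ h (slab t U)) (slab t U) :=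
    hh.continuousOn_fderivWithin (slab_unique ht hU) (by simp)
  set F' : Q → ℝ → Q →L[ℝ] E := fun x τ =>
    (fderivWithin ℝ h (slab t U) (τ, x)).comp (ContinuousLinearMap.inr ℝ ℝ Q) with hF'
  obtain ⟨ε, hε, hball⟩ := Metric.nhds_basis_closedBall.mem_iff.1 (hU.mem_nhds hq)
  have hcF : ContinuousOn (fun p : ℝ × Q => F' p.2 p.1) (slab t U) :=
    hc1.clm_comp continuousOn_const
  have hcomp : IsCompact (Icc (0:ℝ) t ×ˢ Metric.closedBall q ε) :=
    isCompact_Icc.prod (isCompact_closedBall q ε)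
  obtain ⟨M, hM⟩ := hcomp.exists_bound_of_continuousOn
    (hcF.mono (prod_mono subset_rfl hball))
  have hI : Set.uIoc 0 t ⊆ Icc 0 t := by rw [uIoc_of_le ht.le]; exact Ioc_subset_Icc_self
  have hmeas : ∀ x ∈ U, AEStronglyMeasurable (fun τ => h (τ, x))
      (volume.restrict (Set.uIoc 0 t)) := fun x hx =>
    ((slab_cont hh.continuousOn hx).mono hI).aestronglyMeasurable measurableSet_uIoc
  have hcq : ContinuousOn (F' q) (Icc 0 t) := slab_cont hcF hq
  have key := intervalIntegral.hasFDerivAt_integral_of_dominated_of_fderiv_le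
    (𝕜 := ℝ) (μ := volume) (a := 0) (b := t) (F := fun x τ => h (τ, x)) (F' := F') (x₀ := q)
    (s := Metric.closedBall q ε) (bound := fun _ => M) (Metric.closedBall_mem_nhds q hε)
    (by filter_upwards [hU.mem_nhds hq] with x hx using hmeas x hx)
    (ContinuousOn.intervalIntegrable (by rw [uIcc_of_le ht.le]; exact slab_cont hh.continuousOn hq))
    ((hcq.mono hI).aestronglyMeasurable measurableSet_uIoc)
    (Filter.Eventually.of_forall fun τ hτ x hx => hM (τ, x) ⟨hI hτ, hx⟩)
    (by simp)
    (Filter.Eventually.of_forall fun τ hτ x hx => slab_hasFDeriv_Q hU hh (hI hτ) (hball hx))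
  refine ⟨_, key, fun w => ?_⟩
  rw [ContinuousLinearMap.intervalIntegral_apply
    (ContinuousOn.intervalIntegrable (by rw [uIcc_of_le ht.le]; exact hcq))]
  rfl

end generic

section linear

/-- A path with velocity and acceleration in the interior of `[0,t]`. -/
structure JD {n : ℕ} (t : ℝ) (x v a : ℝ → Fin n → ℝ) : Prop where
  cx : ∀ i, ContinuousOn (fun τ => x τ i) (Icc 0 t)
  cv : ∀ i, ContinuousOn (fun τ => v τ i) (Icc 0 t)
  dx : ∀ τ ∈ Ioo 0 t, ∀ i, HasDerivAt (fun s => x s i) (v τ i) τ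
  dv : ∀ τ ∈ Ioo 0 t, ∀ i, HasDerivAt (fun s => v s i) (a τ i) τ

/-- Second-order linear operator. -/
def Dop {n : ℕ} (F M : ℝ → Fin n → Fin n → ℝ) (x v a : ℝ → Fin n → ℝ) (τ : ℝ) (i : Fin n) : ℝ :=
  a τ i + (∑ j, F τ i j * v τ j) + ∑ j, M τ i j * x τ j

/-- The Wronskian pairing. -/
def Wr {n : ℕ} (F : ℝ → Fin n → Fin n → ℝ) (x v y w : ℝ → Fin n → ℝ) (τ : ℝ) : ℝ :=
  (∑ i, (x τ i * w τ i - y τ i * v τ i)) + ∑ i, ∑ j, x τ i * F τ i j * y τ j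

/-- Coefficients of a formally self-adjoint operator. -/
structure Coef {n : ℕ} (t : ℝ) (F M Fd : ℝ → Fin n → Fin n → ℝ) : Prop where
  cF : ∀ i j, ContinuousOn (fun τ => F τ i j) (Icc 0 t)
  cM : ∀ i j, ContinuousOn (fun τ => M τ i j) (Icc 0 t)
  dF : ∀ τ ∈ Ioo 0 t, ∀ i j, HasDerivAt (fun s => F s i j) (Fd τ i j) τ
  anti : ∀ τ i j, F τ i j = - F τ j i
  bianchi : ∀ τ ∈ Ioo 0 t, ∀ i j, Fd τ i j = M τ i j - M τ j i

variable {n : ℕ} {t : ℝ} {F M Fd : ℝ → Fin n → Fin n → ℝ}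

lemma Wr_deriv (hc : Coef t F M Fd) {x v a y w b : ℝ → Fin n → ℝ} (hx : JD t x v a)
    (hy : JD t y w b) {τ : ℝ} (hτ : τ ∈ Ioo 0 t) :
    HasDerivAt (Wr F x v y w)
      ((∑ i, x τ i * Dop F M y w b τ i) - ∑ i, y τ i * Dop F M x v a τ i) τ := by
  have h1 : HasDerivAt (fun s => ∑ i, (x s i * w s i - y s i * v s i))
      (∑ i, ((v τ i * w τ i + x τ i * b τ i) - (w τ i * v τ i + y τ i * a τ i))) τ := by
    apply HasDerivAt.fun_sum
    intro i _
    exact ((hx.dx τ hτ i).mul (hy.dv τ hτ i)).sub ((hy.dx τ hτ i).mul (hx.dv τ hτ i))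
  have h2 : HasDerivAt (fun s => ∑ i, ∑ j, x s i * F s i j * y s j)
      (∑ i, ∑ j, ((v τ i * F τ i j + x τ i * Fd τ i j) * y τ j + x τ i * F τ i j * w τ j)) τ := by
    apply HasDerivAt.fun_sum
    intro i _
    apply HasDerivAt.fun_sum
    intro j _
    exact ((hx.dx τ hτ i).mul (hc.dF τ hτ i j)).mul (hy.dx τ hτ j)
  refine (h1.add h2).congr_deriv ?_
  have e1 : ∑ i, ∑ j, y τ i * (F τ i j * v τ j) = - ∑ i, ∑ j, v τ i * F τ i j * y τ j := by
    rw [Finset.sum_comm, ← Finset.sum_neg_distrib]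
    refine Finset.sum_congr rfl fun i _ => ?_
    rw [← Finset.sum_neg_distrib]
    refine Finset.sum_congr rfl fun j _ => ?_
    rw [hc.anti τ j i]; ring
  have e2 : ∑ i, ∑ j, y τ i * (M τ i j * x τ j) = ∑ i, ∑ j, x τ i * M τ j i * y τ j := by
    rw [Finset.sum_comm]
    refine Finset.sum_congr rfl fun i _ => Finset.sum_congr rfl fun j _ => ?_
    ring
  have e3 : ∑ i, ∑ j, x τ i * Fd τ i j * y τ j
      = ∑ i, ∑ j, x τ i * (M τ i j * y τ j) - ∑ i, ∑ j, x τ i * M τ j i * y τ j := by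
    rw [← Finset.sum_sub_distrib]
    refine Finset.sum_congr rfl fun i _ => ?_
    rw [← Finset.sum_sub_distrib]
    refine Finset.sum_congr rfl fun j _ => ?_
    rw [hc.bianchi τ hτ i j]; ring
  have e4 : ∑ i, ∑ j, x τ i * F τ i j * w τ j = ∑ i, ∑ j, x τ i * (F τ i j * w τ j) := by
    refine Finset.sum_congr rfl fun i _ => Finset.sum_congr rfl fun j _ => ?_
    ring
  have e5 : ∑ i, v τ i * w τ i = ∑ i, w τ i * v τ i := by
    refine Finset.sum_congr rfl fun i _ => ?_
    ring
  simp only [Dop, mul_add, add_mul, Finset.sum_add_distrib, Finset.sum_sub_distrib, Finset.mul_sum]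
  rw [e1, e2, e3, e4, e5]
  ring

lemma Wr_cont (hc : Coef t F M Fd) {x v a y w b : ℝ → Fin n → ℝ} (hx : JD t x v a)
    (hy : JD t y w b) : ContinuousOn (Wr F x v y w) (Icc 0 t) := by
  apply ContinuousOn.add
  · refine continuousOn_finsetSum _ fun i _ => ?_
    exact ((hx.cx i).mul (hy.cv i)).sub ((hy.cx i).mul (hx.cv i))
  · refine continuousOn_finsetSum _ fun i _ => continuousOn_finsetSum _ fun j _ => ?_
    exact ((hx.cx i).mul (hc.cF i j)).mul (hy.cx j)

lemma Wr_integral (hc : Coef t F M Fd) {x v a y w b : ℝ → Fin n → ℝ} (hx : JD t x v a)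
    (hy : JD t y w b) (hD : ∀ τ ∈ Ioo 0 t, ∀ i, Dop F M x v a τ i = 0)
    (hyc : ∀ i, ContinuousOn (fun τ => Dop F M y w b τ i) (Icc 0 t))
    {α β : ℝ} (hα : 0 ≤ α) (hαβ : α ≤ β) (hβ : β ≤ t) :
    ∫ τ in α..β, ∑ i, x τ i * Dop F M y w b τ i = Wr F x v y w β - Wr F x v y w α := by
  have hsub : Icc α β ⊆ Icc 0 t := Icc_subset_Icc hα hβ
  apply intervalIntegral.integral_eq_sub_of_hasDerivAt_of_le hαβ ((Wr_cont hc hx hy).mono hsub)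
  · intro τ hτ
    have hτ' : τ ∈ Ioo 0 t := Ioo_subset_Ioo hα hβ hτ
    have := Wr_deriv hc hx hy hτ'
    simpa [hD τ hτ'] using this
  · apply ContinuousOn.intervalIntegrable
    rw [uIcc_of_le hαβ]
    refine (continuousOn_finsetSum _ fun i _ => ?_)
    exact ((hx.cx i).mul (hyc i)).mono hsub

lemma Wr_const (hc : Coef t F M Fd) {x v a y w b : ℝ → Fin n → ℝ} (hx : JD t x v a)
    (hy : JD t y w b) (hD : ∀ τ ∈ Ioo 0 t, ∀ i, Dop F M x v a τ i = 0)
    (hD' : ∀ τ ∈ Ioo 0 t, ∀ i, Dop F M y w b τ i = 0)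
    {α : ℝ} (hα : α ∈ Icc 0 t) : Wr F x v y w α = Wr F x v y w t := by
  have h : ∫ τ in α..t, (0:ℝ) = Wr F x v y w t - Wr F x v y w α := by
    apply intervalIntegral.integral_eq_sub_of_hasDerivAt_of_le hα.2
      ((Wr_cont hc hx hy).mono (Icc_subset_Icc hα.1 le_rfl))
    · intro τ hτ
      have hτ' : τ ∈ Ioo 0 t := Ioo_subset_Ioo hα.1 le_rfl hτ
      have := Wr_deriv hc hx hy hτ'
      simpa [hD τ hτ', hD' τ hτ'] using this
    · simp
  simp at h
  linarith

/-- Uniqueness for the linear equation with vanishing final data. -/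
lemma JD_unique (ht : 0 < t) (hc : Coef t F M Fd) {x v a : ℝ → Fin n → ℝ} (hx : JD t x v a)
    (hD : ∀ τ ∈ Ioo 0 t, ∀ i, Dop F M x v a τ i = 0)
    (h0 : ∀ i, x t i = 0) (h1 : ∀ i, v t i = 0) : ∀ i, x 0 i = 0 := by
  obtain ⟨c, hcb⟩ : ∃ c : ℝ, ∀ τ ∈ Icc 0 t, ∀ i j, |M τ i j| ≤ c := by
    have hb : ∀ i j, ∃ c : ℝ, ∀ τ ∈ Icc 0 t, |M τ i j| ≤ c := fun i j =>
      isCompact_Icc.exists_bound_of_continuousOn (hc.cM i j)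
    choose c hcc using hb
    refine ⟨∑ i, ∑ j, |c i j|, fun τ hτ i j => ?_⟩
    calc |M τ i j| ≤ |c i j| := (hcc i j τ hτ).trans (le_abs_self _)
      _ ≤ ∑ j, |c i j| := Finset.single_le_sum (f := fun j => |c i j|)
          (fun _ _ => abs_nonneg _) (Finset.mem_univ j)
      _ ≤ _ := Finset.single_le_sum (f := fun i => ∑ j, |c i j|)
          (fun _ _ => Finset.sum_nonneg fun _ _ => abs_nonneg _) (Finset.mem_univ i)
  set K : ℝ := 1 + c * n with hK
  set E : ℝ → ℝ := fun τ => ∑ i, (x τ i ^ 2 + v τ i ^ 2) with hE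
  have hEd : ∀ τ ∈ Ioo 0 t, HasDerivAt E (∑ i, (2 * x τ i * v τ i + 2 * v τ i * a τ i)) τ := by
    intro τ hτ
    apply HasDerivAt.fun_sum
    intro i _
    have := ((hx.dx τ hτ i).pow 2).add ((hx.dv τ hτ i).pow 2)
    refine this.congr_deriv ?_
    push_cast
    ring
  have hineq : ∀ τ ∈ Ioo 0 t, 0 ≤ (∑ i, (2 * x τ i * v τ i + 2 * v τ i * a τ i)) + K * E τ := by
    intro τ hτ
    have ha : ∀ i, a τ i = -(∑ j, F τ i j * v τ j) - ∑ j, M τ i j * x τ j := by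
      intro i
      have := hD τ hτ i
      simp only [Dop] at this
      linarith
    have hanti : ∑ i, ∑ j, v τ i * (F τ i j * v τ j) = 0 := by
      have : ∑ i, ∑ j, v τ i * (F τ i j * v τ j) = - ∑ i, ∑ j, v τ i * (F τ i j * v τ j) := by
        conv_lhs => rw [Finset.sum_comm]
        rw [← Finset.sum_neg_distrib]
        refine Finset.sum_congr rfl fun i _ => ?_
        rw [← Finset.sum_neg_distrib]
        refine Finset.sum_congr rfl fun j _ => ?_
        rw [hc.anti τ j i]; ring
      linarith
    have hMb : ∑ i, ∑ j, 2 * (v τ i * (M τ i j * x τ j))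
        ≤ ∑ i, ∑ j : Fin n, (c * v τ i ^ 2 + c * x τ j ^ 2) := by
      refine Finset.sum_le_sum fun i _ => Finset.sum_le_sum fun j _ => ?_
      have hb := abs_le.1 (hcb τ (Ioo_subset_Icc_self hτ) i j)
      nlinarith [mul_nonneg (sub_nonneg.2 hb.2) (sq_nonneg (v τ i + x τ j)),
        mul_nonneg (by linarith [hb.1] : 0 ≤ c + M τ i j) (sq_nonneg (v τ i - x τ j))]
    have e1 : ∑ i, ∑ j : Fin n, (c * v τ i ^ 2 + c * x τ j ^ 2) = c * n * E τ := by
      simp only [Finset.sum_add_distrib, hE, ← Finset.mul_sum, Finset.sum_const,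
        Finset.card_univ, Fintype.card_fin, nsmul_eq_mul]
      ring
    have e2 : ∑ i, (2 * x τ i * v τ i + 2 * v τ i * a τ i)
        = ∑ i, 2 * x τ i * v τ i - 2 * ∑ i, ∑ j, v τ i * (F τ i j * v τ j)
          - ∑ i, ∑ j, 2 * (v τ i * (M τ i j * x τ j)) := by
      rw [Finset.mul_sum, ← Finset.sum_sub_distrib, ← Finset.sum_sub_distrib]
      refine Finset.sum_congr rfl fun i _ => ?_
      rw [ha i, ← Finset.mul_sum, ← Finset.mul_sum, ← Finset.mul_sum]
      ring
    have e3 : 0 ≤ ∑ i, 2 * x τ i * v τ i + E τ := by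
      rw [hE, ← Finset.sum_add_distrib]
      refine Finset.sum_nonneg fun i _ => ?_
      nlinarith [sq_nonneg (x τ i + v τ i)]
    rw [e2, hanti, hK]
    linarith
  have hEc : ContinuousOn E (Icc 0 t) := by
    refine continuousOn_finsetSum _ fun i _ => ?_
    exact ((hx.cx i).pow 2).add ((hx.cv i).pow 2)
  have hder : ∀ τ ∈ Ioo 0 t, HasDerivAt (fun s => E s * Real.exp (K * s))
      ((∑ i, (2 * x τ i * v τ i + 2 * v τ i * a τ i)) * Real.exp (K * τ)
        + E τ * (Real.exp (K * τ) * K)) τ := by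
    intro τ hτ
    have h2 : HasDerivAt (fun s => Real.exp (K * s)) (Real.exp (K * τ) * K) τ := by
      simpa using ((hasDerivAt_id τ).const_mul K).exp
    exact (hEd τ hτ).mul h2
  have hmono : MonotoneOn (fun s => E s * Real.exp (K * s)) (Icc 0 t) := by
    apply monotoneOn_of_deriv_nonneg (convex_Icc 0 t)
    · exact hEc.mul (by fun_prop)
    · rw [interior_Icc]
      intro τ hτ
      exact (hder τ hτ).differentiableAt.differentiableWithinAt
    · rw [interior_Icc]
      intro τ hτ
      rw [(hder τ hτ).deriv]
      have := mul_nonneg (hineq τ hτ) (Real.exp_pos (K * τ)).le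
      nlinarith
  have h2 := hmono (left_mem_Icc.2 ht.le) (right_mem_Icc.2 ht.le) ht.le
  have hEt : E t = 0 := by simp [hE, h0, h1]
  have hE0 : E 0 ≤ 0 := by simpa [hEt] using h2
  intro i
  have h3 : x 0 i ^ 2 + v 0 i ^ 2 ≤ E 0 := Finset.single_le_sum
    (f := fun i => x 0 i ^ 2 + v 0 i ^ 2) (fun _ _ => by positivity) (Finset.mem_univ i)
  have h4 : x 0 i ^ 2 = 0 := by nlinarith [sq_nonneg (x 0 i), sq_nonneg (v 0 i)]
  exact pow_eq_zero_iff (two_ne_zero) |>.1 h4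

/-- Linear combinations. -/
lemma JD_sum {φ φd φa : Fin n → ℝ → Fin n → ℝ} (h : ∀ k, JD t (φ k) (φd k) (φa k))
    (c : Fin n → ℝ) : JD t (fun τ i => ∑ k, c k * φ k τ i) (fun τ i => ∑ k, c k * φd k τ i)
      (fun τ i => ∑ k, c k * φa k τ i) where
  cx i := continuousOn_finsetSum _ fun k _ => ((h k).cx i).const_mul (c k)
  cv i := continuousOn_finsetSum _ fun k _ => ((h k).cv i).const_mul (c k)
  dx τ hτ i := HasDerivAt.fun_sum fun k _ => ((h k).dx τ hτ i).const_mul (c k)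
  dv τ hτ i := HasDerivAt.fun_sum fun k _ => ((h k).dv τ hτ i).const_mul (c k)

lemma Dop_sum {φ φd φa : Fin n → ℝ → Fin n → ℝ} (c : Fin n → ℝ) (τ : ℝ) (i : Fin n) :
    Dop F M (fun τ i => ∑ k, c k * φ k τ i) (fun τ i => ∑ k, c k * φd k τ i)
      (fun τ i => ∑ k, c k * φa k τ i) τ i = ∑ k, c k * Dop F M (φ k) (φd k) (φa k) τ i := by
  simp only [Dop, mul_add, Finset.sum_add_distrib, Finset.mul_sum]
  congr 1
  · congr 1
    rw [Finset.sum_comm]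
    refine Finset.sum_congr rfl fun k _ => Finset.sum_congr rfl fun j _ => ?_
    ring
  · rw [Finset.sum_comm]
    refine Finset.sum_congr rfl fun k _ => Finset.sum_congr rfl fun j _ => ?_
    ring

lemma Wr_lin_right {φ φd ψ ψd : Fin n → ℝ → Fin n → ℝ} {x v y w : ℝ → Fin n → ℝ} {τ : ℝ}
    (a b : Fin n → ℝ)
    (hy : ∀ i, y τ i = ∑ k, a k * φ k τ i + ∑ k, b k * ψ k τ i)
    (hw : ∀ i, w τ i = ∑ k, a k * φd k τ i + ∑ k, b k * ψd k τ i) :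
    Wr F x v y w τ = ∑ k, a k * Wr F x v (φ k) (φd k) τ + ∑ k, b k * Wr F x v (ψ k) (ψd k) τ := by
  have key : ∀ (a : Fin n → ℝ) (φ φd : Fin n → ℝ → Fin n → ℝ),
      ∑ k, a k * Wr F x v (φ k) (φd k) τ =
        (∑ i, (x τ i * (∑ k, a k * φd k τ i) - (∑ k, a k * φ k τ i) * v τ i))
          + ∑ i, ∑ j, x τ i * F τ i j * (∑ k, a k * φ k τ j) := by
    intro a φ φd
    simp only [Wr, mul_add, Finset.sum_add_distrib]
    congr 1
    · simp only [Finset.mul_sum, Finset.sum_mul, ← Finset.sum_sub_distrib]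
      rw [Finset.sum_comm]
      refine Finset.sum_congr rfl fun k _ => Finset.sum_congr rfl fun j _ => ?_
      ring
    · simp only [Finset.mul_sum]
      rw [Finset.sum_comm]
      refine Finset.sum_congr rfl fun i _ => ?_
      rw [Finset.sum_comm]
      refine Finset.sum_congr rfl fun k _ => Finset.sum_congr rfl fun j _ => ?_
      ring
  rw [key, key]
  simp only [Wr, hy, hw, mul_add, add_mul, Finset.sum_add_distrib, Finset.sum_sub_distrib]
  ring

lemma Wr_swap (hc : Coef t F M Fd) (x v y w : ℝ → Fin n → ℝ) (τ : ℝ) :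
    Wr F x v y w τ = - Wr F y w x v τ := by
  have e : ∑ i, ∑ j, x τ i * F τ i j * y τ j = - ∑ i, ∑ j, y τ i * F τ i j * x τ j := by
    rw [Finset.sum_comm, ← Finset.sum_neg_distrib]
    refine Finset.sum_congr rfl fun i _ => ?_
    rw [← Finset.sum_neg_distrib]
    refine Finset.sum_congr rfl fun j _ => ?_
    rw [hc.anti τ j i]; ring
  simp only [Wr]
  rw [e]
  simp only [Finset.sum_sub_distrib]
  ring

end linear

section core

variable {n : ℕ} {t : ℝ} {F M Fd : ℝ → Fin n → Fin n → ℝ}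

lemma core_det (ht : 0 < t) (hc : Coef t F M Fd) {φ φd φa : Fin n → ℝ → Fin n → ℝ}
    (hφ : ∀ k, JD t (φ k) (φd k) (φa k))
    (hDφ : ∀ k, ∀ τ ∈ Ioo 0 t, ∀ i, Dop F M (φ k) (φd k) (φa k) τ i = 0)
    (hφ0 : ∀ k i, φ k 0 i = (Pi.single k 1 : Fin n → ℝ) i) (hφt : ∀ k i, φ k t i = 0)
    (H : Matrix (Fin n) (Fin n) ℝ) (hH : ∀ k l, H k l = - φd k t l) : IsUnit H.det := by
  rw [isUnit_iff_ne_zero]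
  intro hdet
  obtain ⟨c, hc0, hcH⟩ := Matrix.exists_vecMul_eq_zero_iff.2 hdet
  have h := JD_unique ht hc (JD_sum hφ c)
    (fun τ hτ i => by rw [Dop_sum]; simp [hDφ _ τ hτ])
    (fun i => by simp [hφt])
    (fun i => by
      have := congrFun hcH i
      simp only [Matrix.vecMul, dotProduct, hH, Pi.zero_apply, mul_neg,
        Finset.sum_neg_distrib, neg_eq_zero] at this
      exact this)
  apply hc0
  funext i
  have := h i
  simpa [hφ0, Pi.single_apply] using this

lemma core_green (hc : Coef t F M Fd) {φ φd φa ψ ψd ψa : Fin n → ℝ → Fin n → ℝ}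
    (hφ : ∀ k, JD t (φ k) (φd k) (φa k)) (hψ : ∀ k, JD t (ψ k) (ψd k) (ψa k))
    (hDφ : ∀ k, ∀ τ ∈ Ioo 0 t, ∀ i, Dop F M (φ k) (φd k) (φa k) τ i = 0)
    (hDψ : ∀ k, ∀ τ ∈ Ioo 0 t, ∀ i, Dop F M (ψ k) (ψd k) (ψa k) τ i = 0)
    (hφt : ∀ k i, φ k t i = 0)
    (hψ0 : ∀ k i, ψ k 0 i = 0) (hψt : ∀ k i, ψ k t i = (Pi.single k 1 : Fin n → ℝ) i)
    (H : Matrix (Fin n) (Fin n) ℝ) (hH : ∀ k l, H k l = - φd k t l) (hu : IsUnit H.det)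
    (x v : ℝ → Fin n → ℝ) {ς : ℝ} (hς : ς ∈ Icc 0 t) (i : Fin n) :
    (∑ k, ∑ l, φ k ς i * (H.transpose)⁻¹ k l * Wr F (ψ l) (ψd l) x v ς)
      + (∑ k, ∑ l, ψ k ς i * H⁻¹ k l * (- Wr F (φ l) (φd l) x v ς)) = - x ς i := by
  have h0t : (0:ℝ) ∈ Icc 0 t := left_mem_Icc.2 (hς.1.trans hς.2)
  have W1 : ∀ k l, Wr F (φ k) (φd k) (ψ l) (ψd l) ς = H k l := by
    intro k l
    rw [Wr_const hc (hφ k) (hψ l) (hDφ k) (hDψ l) hς]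
    simp [Wr, hφt, hψt, hH, Pi.single_apply]
  have W2 : ∀ k l, Wr F (φ k) (φd k) (φ l) (φd l) ς = 0 := by
    intro k l
    rw [Wr_const hc (hφ k) (hφ l) (hDφ k) (hDφ l) hς]
    simp [Wr, hφt]
  have W3 : ∀ k l, Wr F (ψ k) (ψd k) (ψ l) (ψd l) ς = 0 := by
    intro k l
    rw [Wr_const hc (hψ k) (hψ l) (hDψ k) (hDψ l) hς,
      ← Wr_const hc (hψ k) (hψ l) (hDψ k) (hDψ l) h0t]
    simp [Wr, hψ0]
  have W4 : ∀ k l, Wr F (ψ l) (ψd l) (φ k) (φd k) ς = - H k l := by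
    intro k l
    rw [Wr_swap hc, W1]
  let T : ((Fin n → ℝ) × (Fin n → ℝ)) →ₗ[ℝ] ((Fin n → ℝ) × (Fin n → ℝ)) :=
    { toFun := fun p => (fun i => ∑ k, p.1 k * φ k ς i + ∑ k, p.2 k * ψ k ς i,
        fun i => ∑ k, p.1 k * φd k ς i + ∑ k, p.2 k * ψd k ς i)
      map_add' := by
        intro p q
        ext i <;> simp [add_mul, Finset.sum_add_distrib] <;> ring
      map_smul' := by
        intro c p
        ext i <;> simp [mul_assoc, Finset.mul_sum, mul_add] }
  have hinj : Function.Injective T := by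
    rw [← LinearMap.ker_eq_bot, LinearMap.ker_eq_bot']
    rintro ⟨a, b⟩ hT
    have hT1 : ∀ i, (0:ℝ) = ∑ k, a k * φ k ς i + ∑ k, b k * ψ k ς i := fun i =>
      (congrFun (congrArg Prod.fst hT) i).symm
    have hT2 : ∀ i, (0:ℝ) = ∑ k, a k * φd k ς i + ∑ k, b k * ψd k ς i := fun i =>
      (congrFun (congrArg Prod.snd hT) i).symm
    have hz : ∀ x v, Wr F x v (fun _ _ => (0:ℝ)) (fun _ _ => (0:ℝ)) ς = 0 := by
      intro x v; simp [Wr]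
    have ha : Matrix.vecMul a H = 0 := by
      funext l
      have h1 := Wr_lin_right (F := F) (x := ψ l) (v := ψd l) (y := fun _ _ => (0:ℝ))
        (w := fun _ _ => (0:ℝ)) (τ := ς) a b hT1 hT2
      rw [hz] at h1
      simp only [W3, W4, mul_neg, mul_zero, Finset.sum_const_zero, add_zero,
        Finset.sum_neg_distrib] at h1
      simp only [Matrix.vecMul, dotProduct, Pi.zero_apply]
      linarith
    have hb : Matrix.mulVec H b = 0 := by
      funext l
      have h1 := Wr_lin_right (F := F) (x := φ l) (v := φd l) (y := fun _ _ => (0:ℝ))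
        (w := fun _ _ => (0:ℝ)) (τ := ς) a b hT1 hT2
      rw [hz] at h1
      simp only [W1, W2, mul_zero, Finset.sum_const_zero, zero_add] at h1
      simp only [Matrix.mulVec, dotProduct, Pi.zero_apply]
      rw [h1]
      exact Finset.sum_congr rfl fun k _ => mul_comm _ _
    have ha' : a = 0 := by
      have := congrArg (fun u => Matrix.vecMul u H⁻¹) ha
      simpa [Matrix.vecMul_vecMul, Matrix.mul_nonsing_inv H hu] using this
    have hb' : b = 0 := by
      have := congrArg (fun u => Matrix.mulVec H⁻¹ u) hb
      simpa [Matrix.mulVec_mulVec, Matrix.nonsing_inv_mul H hu] using this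
    rw [ha', hb']; rfl
  have hsurj := LinearMap.injective_iff_surjective.1 hinj
  obtain ⟨⟨a, b⟩, hab⟩ := hsurj (x ς, v ς)
  have hx : ∀ i, x ς i = ∑ k, a k * φ k ς i + ∑ k, b k * ψ k ς i := fun i =>
    (congrFun (congrArg Prod.fst hab) i).symm
  have hv : ∀ i, v ς i = ∑ k, a k * φd k ς i + ∑ k, b k * ψd k ς i := fun i =>
    (congrFun (congrArg Prod.snd hab) i).symm
  have w1 : ∀ l, Wr F (ψ l) (ψd l) x v ς = - Matrix.vecMul a H l := by
    intro l
    rw [Wr_lin_right a b hx hv]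
    simp [W3, W4, Matrix.vecMul, dotProduct]
  have w2 : ∀ l, Wr F (φ l) (φd l) x v ς = Matrix.mulVec H b l := by
    intro l
    rw [Wr_lin_right a b hx hv]
    simp [W1, W2, Matrix.mulVec, dotProduct, mul_comm]
  have s1 : ∀ k, ∑ l, (H.transpose)⁻¹ k l * Matrix.vecMul a H l = a k := by
    intro k
    have : Matrix.vecMul (Matrix.vecMul a H) H⁻¹ = a := by
      simp [Matrix.vecMul_vecMul, Matrix.mul_nonsing_inv H hu]
    rw [← Matrix.transpose_nonsing_inv]
    conv_rhs => rw [← this]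
    change _ = ∑ l, Matrix.vecMul a H l * H⁻¹ l k
    exact Finset.sum_congr rfl fun k _ => mul_comm _ _
  have s2 : ∀ k, ∑ l, H⁻¹ k l * Matrix.mulVec H b l = b k := by
    intro k
    have : Matrix.mulVec H⁻¹ (Matrix.mulVec H b) = b := by
      simp [Matrix.mulVec_mulVec, Matrix.nonsing_inv_mul H hu]
    conv_rhs => rw [← this]
    rfl
  simp only [w1, w2, mul_neg, mul_assoc, Finset.sum_neg_distrib, ← Finset.mul_sum, s1, s2]
  rw [hx i]
  simp only [mul_comm (φ _ ς i), mul_comm (ψ _ ς i)]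
  ring

end core

section conc

lemma pd_smooth {n : ℕ} {f : (Fin n → ℝ) → ℝ} (hf : ContDiff ℝ (⊤ : ℕ∞) f) (j : Fin n) :
    ContDiff ℝ (⊤ : ℕ∞) (pd f j) :=
  (hf.fderiv_right (m := (⊤ : ℕ∞)) (by simp)).clm_apply contDiff_const

lemma pd_comm {n : ℕ} {f : (Fin n → ℝ) → ℝ} (hf : ContDiff ℝ (⊤ : ℕ∞) f) (i j : Fin n)
    (q : Fin n → ℝ) : pd (pd f i) j q = pd (pd f j) i q := by
  have hsym : IsSymmSndFDerivAt ℝ f q := hf.contDiffAt.isSymmSndFDerivAt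
    (by simp; exact WithTop.coe_le_coe.2 (le_top (a := (2:ℕ∞))))
  have hd : DifferentiableAt ℝ (fderiv ℝ f) q :=
    ((hf.fderiv_right (m := 1) (by norm_cast)).differentiable (by simp)) q
  have e : ∀ i j, pd (pd f i) j q = fderiv ℝ (fderiv ℝ f) q (Pi.single j 1) (Pi.single i 1) := by
    intro i j
    change fderiv ℝ (fun p => fderiv ℝ f p (Pi.single i 1)) q (Pi.single j 1) = _
    rw [fderiv_clm_apply hd (differentiableAt_const _)]
    simp
  rw [e, e, hsym.eq]

lemma pd_sub {n : ℕ} {f g : (Fin n → ℝ) → ℝ} (hf : ContDiff ℝ (⊤ : ℕ∞) f)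
    (hg : ContDiff ℝ (⊤ : ℕ∞) g) (j : Fin n) (q : Fin n → ℝ) :
    pd (fun q => f q - g q) j q = pd f j q - pd g j q := by
  simp only [pd]
  rw [fderiv_fun_sub ((hf.differentiable (by simp)) q) ((hg.differentiable (by simp)) q)]
  rfl

lemma pd_chain {n : ℕ} {f : (Fin n → ℝ) → ℝ} (hf : ContDiff ℝ (⊤ : ℕ∞) f)
    {x : ℝ → Fin n → ℝ} {x' y : Fin n → ℝ} {s : ℝ} (hx : HasDerivAt x x' s) (hy : x s = y) :
    HasDerivAt (fun s => f (x s)) (∑ j, pd f j y * x' j) s := by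
  subst hy
  have h1 := ((hf.differentiable (by simp)) (x s)).hasFDerivAt.comp_hasDerivAt s hx
  refine h1.congr_deriv ?_
  conv_lhs => rw [← Finset.univ_sum_single x', map_sum]
  refine Finset.sum_congr rfl fun j _ => ?_
  have : (Pi.single j (x' j) : Fin n → ℝ) = x' j • Pi.single j 1 := by
    rw [← Pi.single_smul]; simp
  rw [this, map_smul, smul_eq_mul, mul_comm, pd]

/-- Field strength. -/
abbrev fs {n : ℕ} (B : Fin n → (Fin n → ℝ) → ℝ) (i k : Fin n) : (Fin n → ℝ) → ℝ :=
  fun q => pd (B i) k q - pd (B k) i q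

lemma fs_smooth {n : ℕ} {B : Fin n → (Fin n → ℝ) → ℝ} (hB : ∀ i, ContDiff ℝ (⊤ : ℕ∞) (B i))
    (i k : Fin n) : ContDiff ℝ (⊤ : ℕ∞) (fs B i k) :=
  (pd_smooth (hB i) k).sub (pd_smooth (hB k) i)

/-- First-order coefficient of the Jacobi operator. -/
def cF {n : ℕ} (B : Fin n → (Fin n → ℝ) → ℝ) (γ : ℝ → Fin n → ℝ) (τ : ℝ) (i j : Fin n) : ℝ :=
  fs B i j (γ τ)

/-- Zeroth-order coefficient of the Jacobi operator. -/
def cM {n : ℕ} (B : Fin n → (Fin n → ℝ) → ℝ) (C : (Fin n → ℝ) → ℝ) (γ : ℝ → Fin n → ℝ) (τ : ℝ)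
    (i j : Fin n) : ℝ :=
  (∑ k, pd (fs B i k) j (γ τ) * deriv γ τ k) + pd (pd C i) j (γ τ)

lemma Jacobi_eq {n : ℕ} (B : Fin n → (Fin n → ℝ) → ℝ) (C : (Fin n → ℝ) → ℝ)
    (γ ξ : ℝ → Fin n → ℝ) (τ : ℝ) (i : Fin n) :
    Jacobi B C γ ξ τ i = Dop (cF B γ) (cM B C γ) ξ (deriv ξ) (deriv (deriv ξ)) τ i := rfl

lemma path_deriv_smooth {n : ℕ} {γ : ℝ → Fin n → ℝ} (hγ : ContDiff ℝ (⊤ : ℕ∞) γ) :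
    ContDiff ℝ (⊤ : ℕ∞) (deriv γ) :=
  (contDiff_infty_iff_deriv.1 hγ).2

lemma path_hasDeriv {n : ℕ} {γ : ℝ → Fin n → ℝ} (hγ : ContDiff ℝ (⊤ : ℕ∞) γ) (τ : ℝ) :
    HasDerivAt γ (deriv γ τ) τ :=
  ((hγ.differentiable (by simp)) τ).hasDerivAt

lemma path_JD {n : ℕ} {ξ : ℝ → Fin n → ℝ} (hξ : ContDiff ℝ (⊤ : ℕ∞) ξ) (t : ℝ) :
    JD t ξ (deriv ξ) (deriv (deriv ξ)) where
  cx i := ((continuous_apply i).comp hξ.continuous).continuousOn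
  cv i := ((continuous_apply i).comp (path_deriv_smooth hξ).continuous).continuousOn
  dx τ _ i := (hasDerivAt_pi.1 (path_hasDeriv hξ τ)) i
  dv τ _ i := (hasDerivAt_pi.1 (path_hasDeriv (path_deriv_smooth hξ) τ)) i

variable {n : ℕ} {B : Fin n → (Fin n → ℝ) → ℝ} {C : (Fin n → ℝ) → ℝ}

lemma coef_path (hB : ∀ i, ContDiff ℝ (⊤ : ℕ∞) (B i)) (hC : ContDiff ℝ (⊤ : ℕ∞) C)
    {γ : ℝ → Fin n → ℝ} (hγ : ContDiff ℝ (⊤ : ℕ∞) γ) (t : ℝ) :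
    Coef t (cF B γ) (cM B C γ) (fun τ i j => ∑ k, pd (fs B i j) k (γ τ) * deriv γ τ k) where
  cF i j := ((fs_smooth hB i j).continuous.comp hγ.continuous).continuousOn
  cM i j := by
    apply Continuous.continuousOn
    refine Continuous.add (continuous_finsetSum _ fun k _ => ?_) ?_
    · exact ((pd_smooth (fs_smooth hB i k) j).continuous.comp hγ.continuous).mul
        ((continuous_apply k).comp (path_deriv_smooth hγ).continuous)
    · exact (pd_smooth (pd_smooth hC i) j).continuous.comp hγ.continuous
  dF τ _ i j := pd_chain (fs_smooth hB i j) (path_hasDeriv hγ τ) rfl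
  anti τ i j := by simp [cF]
  bianchi τ _ i j := by
    simp only [cM]
    rw [pd_comm hC i j, add_sub_add_right_eq_sub, ← Finset.sum_sub_distrib]
    refine Finset.sum_congr rfl fun k _ => ?_
    rw [← sub_mul]
    congr 1
    rw [pd_sub (pd_smooth (hB i) j) (pd_smooth (hB j) i),
      pd_sub (pd_smooth (hB i) k) (pd_smooth (hB k) i),
      pd_sub (pd_smooth (hB j) k) (pd_smooth (hB k) j)]
    rw [pd_comm (hB i) j k, pd_comm (hB j) i k, pd_comm (hB k) i j]
    ring

variable {Q : Type*} [NormedAddCommGroup Q] [NormedSpace ℝ Q] {t : ℝ} {U : Set Q}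
  {g : ℝ × Q → Fin n → ℝ}

lemma fam_deriv (ht : 0 < t) (hg : ContDiffOn ℝ (⊤ : ℕ∞) g (slab t U))
    (hp : ∀ q ∈ U, ContDiff ℝ (⊤ : ℕ∞) fun τ => g (τ, q)) {τ : ℝ} (hτ : τ ∈ Icc 0 t)
    {q : Q} (hq : q ∈ U) : deriv (fun s => g (s, q)) τ = dT t U g (τ, q) :=
  (uniqueDiffOn_Icc ht τ hτ).eq_deriv _ (path_hasDeriv (hp q hq) τ).hasDerivWithinAt
    (slab_hasDerivWithin_T hg hτ hq)

lemma fam_deriv2 (ht : 0 < t) (hU : IsOpen U) (hg : ContDiffOn ℝ (⊤ : ℕ∞) g (slab t U))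
    (hp : ∀ q ∈ U, ContDiff ℝ (⊤ : ℕ∞) fun τ => g (τ, q)) {τ : ℝ} (hτ : τ ∈ Icc 0 t)
    {q : Q} (hq : q ∈ U) :
    deriv (deriv (fun s => g (s, q))) τ = dT t U (dT t U g) (τ, q) := by
  have h1 := slab_hasDerivWithin_T (slab_contDiff_dT ht hU hg) hτ hq
  have h2 := (path_hasDeriv (path_deriv_smooth (hp q hq)) τ).hasDerivWithinAt (s := Icc 0 t)
  exact (uniqueDiffOn_Icc ht τ hτ).eq_deriv _ h2
    (h1.congr (fun s hs => fam_deriv ht hg hp hs hq) (fam_deriv ht hg hp hτ hq))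

lemma fam_eom (ht : 0 < t) (hU : IsOpen U) (hg : ContDiffOn ℝ (⊤ : ℕ∞) g (slab t U))
    (hp : ∀ q ∈ U, ContDiff ℝ (⊤ : ℕ∞) fun τ => g (τ, q))
    (hcl : ∀ q ∈ U, IsClassical B C t fun τ => g (τ, q)) {τ : ℝ} (hτ : τ ∈ Icc 0 t)
    {q : Q} (hq : q ∈ U) (i : Fin n) :
    dT t U (dT t U g) (τ, q) i + (∑ j, fs B i j (g (τ, q)) * dT t U g (τ, q) j)
      + pd C i (g (τ, q)) = 0 := by
  have := hcl q hq τ hτ i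
  rw [fam_deriv2 ht hU hg hp hτ hq, fam_deriv ht hg hp hτ hq] at this
  exact this

lemma fam_JD (ht : 0 < t) (hU : IsOpen U) (hg : ContDiffOn ℝ (⊤ : ℕ∞) g (slab t U))
    {q : Q} (hq : q ∈ U) (w : Q) :
    JD t (fun τ => dQ t U g w (τ, q)) (fun τ => dQ t U (dT t U g) w (τ, q))
      (fun τ => dQ t U (dT t U (dT t U g)) w (τ, q)) where
  cx i := (continuous_apply i).comp_continuousOn
    (slab_cont (slab_contDiff_dQ ht hU hg w).continuousOn hq)
  cv i := (continuous_apply i).comp_continuousOn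
    (slab_cont (slab_contDiff_dQ ht hU (slab_contDiff_dT ht hU hg) w).continuousOn hq)
  dx τ hτ i := hasDerivAt_pi.1 (slab_swap hU hg hτ hq w) i
  dv τ hτ i := hasDerivAt_pi.1 (slab_swap hU (slab_contDiff_dT ht hU hg) hτ hq w) i

lemma fam_Dop (hB : ∀ i, ContDiff ℝ (⊤ : ℕ∞) (B i)) (hC : ContDiff ℝ (⊤ : ℕ∞) C)
    (ht : 0 < t) (hU : IsOpen U) (hg : ContDiffOn ℝ (⊤ : ℕ∞) g (slab t U))
    (hp : ∀ q ∈ U, ContDiff ℝ (⊤ : ℕ∞) fun τ => g (τ, q))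
    (hcl : ∀ q ∈ U, IsClassical B C t fun τ => g (τ, q)) {q : Q} (hq : q ∈ U) (w : Q)
    {τ : ℝ} (hτ : τ ∈ Icc 0 t) (i : Fin n) :
    Dop (cF B fun τ => g (τ, q)) (cM B C fun τ => g (τ, q)) (fun τ => dQ t U g w (τ, q))
      (fun τ => dQ t U (dT t U g) w (τ, q))
      (fun τ => dQ t U (dT t U (dT t U g)) w (τ, q)) τ i = 0 := by
  have hV := slab_contDiff_dT ht hU hg
  have hA := slab_contDiff_dT ht hU hV
  have d0 := slab_hasDeriv_line hU hg hτ hq w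
  have d1 := hasDerivAt_pi.1 (slab_hasDeriv_line hU hV hτ hq w)
  have d2 := hasDerivAt_pi.1 (slab_hasDeriv_line hU hA hτ hq w)
  have hy : g (τ, q + (0:ℝ) • w) = g (τ, q) := by simp
  have key := ((d2 i).add (HasDerivAt.fun_sum (u := Finset.univ) fun j _ =>
    (pd_chain (fs_smooth hB i j) d0 hy).mul (d1 j))).add (pd_chain (pd_smooth hC i) d0 hy)
  have hz : HasDerivAt (fun _ : ℝ => (0:ℝ)) 0 0 := hasDerivAt_const _ _
  have hev : (fun _ : ℝ => (0:ℝ)) =ᶠ[nhds 0] fun s => dT t U (dT t U g) (τ, q + s • w) i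
      + (∑ j, fs B i j (g (τ, q + s • w)) * dT t U g (τ, q + s • w) j)
      + pd C i (g (τ, q + s • w)) := by
    have hcont : Continuous fun s : ℝ => q + s • w := by fun_prop
    have : ∀ᶠ s in nhds (0:ℝ), q + s • w ∈ U :=
      hcont.continuousAt.eventually_mem (hU.mem_nhds (by simpa using hq))
    filter_upwards [this] with s hs
    exact (fam_eom ht hU hg hp hcl hτ hs i).symm
  have h := (key.congr_of_eventuallyEq hev).unique hz
  simp only [zero_smul, add_zero] at h
  rw [← h]
  simp only [Dop, cF, cM, fam_deriv ht hg hp hτ hq, Finset.sum_add_distrib, add_mul,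
    Finset.sum_mul]
  have e : ∑ j, ∑ k, pd (fs B i k) j (g (τ, q)) * dT t U g (τ, q) k * dQ t U g w (τ, q) j
     = ∑ j, ∑ k, pd (fs B i j) k (g (τ, q)) * dQ t U g w (τ, q) k * dT t U g (τ, q) j := by
    rw [Finset.sum_comm]
    refine Finset.sum_congr rfl fun k _ => Finset.sum_congr rfl fun j _ => ?_
    ring
  rw [e]
  ring

/-- Lagrangian along the family. -/
def lag (B : Fin n → (Fin n → ℝ) → ℝ) (C : (Fin n → ℝ) → ℝ) (t : ℝ) (U : Set Q)
    (g : ℝ × Q → Fin n → ℝ) (p : ℝ × Q) : ℝ :=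
  (1:ℝ)/2 * ∑ i, dT t U g p i ^ 2 + ∑ i, B i (g p) * dT t U g p i - C (g p)

lemma lag_smooth (hB : ∀ i, ContDiff ℝ (⊤ : ℕ∞) (B i)) (hC : ContDiff ℝ (⊤ : ℕ∞) C)
    (ht : 0 < t) (hU : IsOpen U) (hg : ContDiffOn ℝ (⊤ : ℕ∞) g (slab t U)) :
    ContDiffOn ℝ (⊤ : ℕ∞) (lag B C t U g) (slab t U) := by
  have hV := contDiffOn_pi.1 (slab_contDiff_dT ht hU hg)
  refine ((contDiffOn_const.mul (ContDiffOn.sum fun i _ => (hV i).pow 2)).add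
    (ContDiffOn.sum fun i _ => ((hB i).comp_contDiffOn hg).mul (hV i))).sub
    (hC.comp_contDiffOn hg)

lemma lag_dQ (hB : ∀ i, ContDiff ℝ (⊤ : ℕ∞) (B i)) (hC : ContDiff ℝ (⊤ : ℕ∞) C)
    (ht : 0 < t) (hU : IsOpen U) (hg : ContDiffOn ℝ (⊤ : ℕ∞) g (slab t U))
    (hp : ∀ q ∈ U, ContDiff ℝ (⊤ : ℕ∞) fun τ => g (τ, q))
    (hcl : ∀ q ∈ U, IsClassical B C t fun τ => g (τ, q)) {q : Q} (hq : q ∈ U) (w : Q)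
    {τ : ℝ} (hτ : τ ∈ Ioo 0 t) :
    HasDerivAt (fun s => ∑ i, (dT t U g (s, q) i + B i (g (s, q))) * dQ t U g w (s, q) i)
      (dQ t U (lag B C t U g) w (τ, q)) τ := by
  have hτ' := Ioo_subset_Icc_self hτ
  have hV := slab_contDiff_dT ht hU hg
  have d0 := slab_hasDeriv_line hU hg hτ' hq w
  have d1 := hasDerivAt_pi.1 (slab_hasDeriv_line hU hV hτ' hq w)
  have dl := slab_hasDeriv_line hU (lag_smooth hB hC ht hU hg) hτ' hq w
  have hy : g (τ, q + (0:ℝ) • w) = g (τ, q) := by simp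
  have key := ((HasDerivAt.const_mul (1/2:ℝ) (HasDerivAt.fun_sum (u := Finset.univ) fun j _ =>
    (d1 j).pow 2)).add (HasDerivAt.fun_sum (u := Finset.univ) fun j _ =>
    (pd_chain (hB j) d0 hy).mul (d1 j))).sub (pd_chain hC d0 hy)
  rw [dl.unique key]
  have nb : Icc (0:ℝ) t ∈ nhds τ := Icc_mem_nhds hτ.1 hτ.2
  have t0 := (slab_hasDerivWithin_T hg hτ' hq).hasDerivAt nb
  have t1 := hasDerivAt_pi.1 ((slab_hasDerivWithin_T hV hτ' hq).hasDerivAt nb)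
  have t2 := hasDerivAt_pi.1 (slab_swap hU hg hτ hq w)
  have key2 := HasDerivAt.fun_sum (u := Finset.univ) fun i _ =>
    ((t1 i).add (pd_chain (hB i) t0 rfl)).mul (t2 i)
  refine key2.congr_deriv ?_
  have ha : ∀ i, dT t U (dT t U g) (τ, q) i
      = -(∑ j, fs B i j (g (τ, q)) * dT t U g (τ, q) j) - pd C i (g (τ, q)) := fun i => by
    have := fam_eom ht hU hg hp hcl hτ' hq i
    linarith
  simp only [ha, zero_smul, add_zero, fs, sub_mul, add_mul, Finset.sum_add_distrib,
    Finset.sum_sub_distrib, Pi.add_apply, neg_mul, Finset.sum_neg_distrib]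
  have e : ∑ i, (∑ j, pd (B j) i (g (τ, q)) * dT t U g (τ, q) j) * dQ t U g w (τ, q) i
     = ∑ i, (∑ j, pd (B i) j (g (τ, q)) * dQ t U g w (τ, q) j) * dT t U g (τ, q) i := by
    simp only [Finset.sum_mul]
    rw [Finset.sum_comm]
    refine Finset.sum_congr rfl fun k _ => Finset.sum_congr rfl fun j _ => ?_
    ring
  rw [e, Finset.mul_sum]
  have e2 : ∑ i, 1 / 2 * (((2:ℕ):ℝ) * dT t U g (τ, q) i ^ (2 - 1) * dQ t U (dT t U g) w (τ, q) i)
     = ∑ i, dT t U g (τ, q) i * dQ t U (dT t U g) w (τ, q) i := by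
    refine Finset.sum_congr rfl fun k _ => ?_
    push_cast
    ring
  rw [e2]
  ring

lemma fam_action [FiniteDimensional ℝ Q] (hB : ∀ i, ContDiff ℝ (⊤ : ℕ∞) (B i))
    (hC : ContDiff ℝ (⊤ : ℕ∞) C)
    (ht : 0 < t) (hU : IsOpen U) (hg : ContDiffOn ℝ (⊤ : ℕ∞) g (slab t U))
    (hp : ∀ q ∈ U, ContDiff ℝ (⊤ : ℕ∞) fun τ => g (τ, q))
    (hcl : ∀ q ∈ U, IsClassical B C t fun τ => g (τ, q)) {q : Q} (hq : q ∈ U) :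
    ∃ L : Q →L[ℝ] ℝ, HasFDerivAt (fun x => action B C t fun τ => g (τ, x)) L q ∧
      ∀ w, L w = (∑ i, (dT t U g (t, q) i + B i (g (t, q))) * dQ t U g w (t, q) i)
        - ∑ i, (dT t U g (0, q) i + B i (g (0, q))) * dQ t U g w (0, q) i := by
  obtain ⟨L, hL, hLw⟩ := slab_integral ht hU (lag_smooth hB hC ht hU hg) hq
  refine ⟨L, hL.congr_of_eventuallyEq ?_, fun w => ?_⟩
  · filter_upwards [hU.mem_nhds hq] with x hx
    simp only [action]
    apply intervalIntegral.integral_congr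
    intro τ hτ
    rw [uIcc_of_le ht.le] at hτ
    simp only [lag, fam_deriv ht hg hp hτ hx]
  · rw [hLw]
    apply intervalIntegral.integral_eq_sub_of_hasDerivAt_of_le ht.le _
      (fun τ hτ => lag_dQ hB hC ht hU hg hp hcl hq w hτ)
    · apply ContinuousOn.intervalIntegrable
      rw [uIcc_of_le ht.le]
      exact slab_cont (slab_contDiff_dQ ht hU (lag_smooth hB hC ht hU hg) w).continuousOn hq
    · refine continuousOn_finsetSum _ fun i _ => ?_
      have hV := slab_contDiff_dT ht hU hg
      have c1 := (continuous_apply i).comp_continuousOn (slab_cont hV.continuousOn hq)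
      have c2 := (hB i).continuous.comp_continuousOn (slab_cont hg.continuousOn hq)
      exact (c1.add c2).mul ((fam_JD ht hU hg hq w).cx i)

end conc

section final

lemma sum_integral {n : ℕ} {α β : ℝ} (hαβ : α ≤ β) (a : Fin n → ℝ) (m : Matrix (Fin n) (Fin n) ℝ)
    (ψ : Fin n → ℝ → Fin n → ℝ) (J : ℝ → Fin n → ℝ)
    (hψ : ∀ l j, ContinuousOn (fun τ => ψ l τ j) (Icc α β))
    (hJ : ∀ j, ContinuousOn (fun τ => J τ j) (Icc α β)) :
    ∑ j, ∫ τ in α..β, (∑ k, ∑ l, a k * m k l * ψ l τ j) * J τ j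
      = ∑ k, ∑ l, a k * m k l * ∫ τ in α..β, ∑ j, ψ l τ j * J τ j := by
  have hi : ∀ l j, IntervalIntegrable (fun τ => ψ l τ j * J τ j) volume α β := fun l j => by
    apply ContinuousOn.intervalIntegrable
    rw [uIcc_of_le hαβ]
    exact (hψ l j).mul (hJ j)
  have h1 : ∀ j, ∫ τ in α..β, (∑ k, ∑ l, a k * m k l * ψ l τ j) * J τ j
      = ∑ k, ∑ l, a k * m k l * ∫ τ in α..β, ψ l τ j * J τ j := by
    intro j
    simp only [Finset.sum_mul, mul_assoc (a _ * m _ _)]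
    rw [intervalIntegral.integral_finsetSum]
    · refine Finset.sum_congr rfl fun k _ => ?_
      rw [intervalIntegral.integral_finsetSum]
      · refine Finset.sum_congr rfl fun l _ => ?_
        rw [intervalIntegral.integral_const_mul]
      · exact fun l _ => (hi l j).const_mul _
    · intro k _
      apply ContinuousOn.intervalIntegrable
      rw [uIcc_of_le hαβ]
      refine continuousOn_finsetSum _ fun l _ => ?_
      exact ((hψ l j).mul (hJ j)).const_mul _
  simp only [h1]
  rw [Finset.sum_comm]
  refine Finset.sum_congr rfl fun k _ => ?_
  rw [Finset.sum_comm]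
  refine Finset.sum_congr rfl fun l _ => ?_
  rw [intervalIntegral.integral_finsetSum fun j _ => hi l j, Finset.mul_sum]

variable {n : ℕ} {B : Fin n → (Fin n → ℝ) → ℝ} {C : (Fin n → ℝ) → ℝ}
  {O : Set (ℝ × (Fin n → ℝ) × (Fin n → ℝ))}

/-- Parameters at fixed duration. -/
def fU (O : Set (ℝ × (Fin n → ℝ) × (Fin n → ℝ))) (t : ℝ) : Set ((Fin n → ℝ) × (Fin n → ℝ)) :=
  {q | (t, q) ∈ O}

/-- The family at fixed duration. -/
def fg (F : SmoothFamily B C O) (t : ℝ) (p : ℝ × (Fin n → ℝ) × (Fin n → ℝ)) : Fin n → ℝ :=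
  F.f p.1 t p.2.1 p.2.2

lemma fU_open (F : SmoothFamily B C O) (t : ℝ) : IsOpen (fU O t) :=
  F.isOpen.preimage (by fun_prop : Continuous fun q : (Fin n → ℝ) × (Fin n → ℝ) => (t, q))

lemma fg_smooth (F : SmoothFamily B C O) (t : ℝ) :
    ContDiffOn ℝ (⊤ : ℕ∞) (fg F t) (slab t (fU O t)) := by
  have h : ContDiffOn ℝ (⊤ : ℕ∞)
      (fun p : ℝ × (Fin n → ℝ) × (Fin n → ℝ) => (p.1, t, p.2)) (slab t (fU O t)) :=
    (contDiff_fst.prodMk (contDiff_const.prodMk contDiff_snd)).contDiffOn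
  exact F.smooth.comp h (fun p hp => ⟨hp.2, hp.1⟩)

lemma fg_path (F : SmoothFamily B C O) (t : ℝ) (q) (hq : q ∈ fU O t) :
    ContDiff ℝ (⊤ : ℕ∞) fun τ => fg F t (τ, q) := F.pathSmooth (t, q) hq

lemma fg_cl (F : SmoothFamily B C O) (t : ℝ) (q) (hq : q ∈ fU O t) :
    IsClassical B C t fun τ => fg F t (τ, q) := F.isClassical (t, q) hq

lemma fderiv_slice0 {E : Type*} [NormedAddCommGroup E] [NormedSpace ℝ E]
    {h : E × E → ℝ} {L : E × E →L[ℝ] ℝ} {q0 q1 : E} (hh : HasFDerivAt h L (q0, q1)) (w : E) :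
    fderiv ℝ (fun q => h (q, q1)) q0 w = L (w, 0) := by
  have h1 : HasFDerivAt (fun e : E => (e, q1)) (ContinuousLinearMap.inl ℝ E E) q0 :=
    hasFDerivAt_prodMk_left q0 q1
  have h2 : HasFDerivAt (fun q => h (q, q1)) (L.comp (ContinuousLinearMap.inl ℝ E E)) q0 :=
    HasFDerivAt.comp (g := h) (f := fun e : E => (e, q1)) q0 hh h1
  rw [h2.fderiv]; rfl

lemma fderiv_slice1 {E : Type*} [NormedAddCommGroup E] [NormedSpace ℝ E]
    {h : E × E → ℝ} {L : E × E →L[ℝ] ℝ} {q0 q1 : E} (hh : HasFDerivAt h L (q0, q1)) (w : E) :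
    fderiv ℝ (fun q => h (q0, q)) q1 w = L (0, w) := by
  have h1 : HasFDerivAt (fun e : E => (q0, e)) (ContinuousLinearMap.inr ℝ E E) q1 :=
    hasFDerivAt_prodMk_right q0 q1
  have h2 : HasFDerivAt (fun q => h (q0, q)) (L.comp (ContinuousLinearMap.inr ℝ E E)) q1 :=
    HasFDerivAt.comp (g := h) (f := fun e : E => (q0, e)) q1 hh h1
  rw [h2.fderiv]; rfl

lemma slab_comp {t : ℝ} {Q : Type*} [NormedAddCommGroup Q] [NormedSpace ℝ Q] {U : Set Q}
    (hU : IsOpen U) {h : ℝ × Q → Fin n → ℝ}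
    (hh : ContDiffOn ℝ (⊤ : ℕ∞) h (slab t U)) {τ : ℝ} {q : Q} (hτ : τ ∈ Icc 0 t) (hq : q ∈ U)
    (j : Fin n) :
    ∃ L : Q →L[ℝ] ℝ, HasFDerivAt (fun x => h (τ, x) j) L q ∧
      ∀ w, L w = dQ t U h w (τ, q) j :=
  ⟨_, hasFDerivAt_pi'.1 (slab_hasFDeriv_Q hU hh hτ hq) j, fun w => rfl⟩

lemma fg_q0 (F : SmoothFamily B C O) {t : ℝ} {q0 q1 : Fin n → ℝ} (hq : (q0, q1) ∈ fU O t)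
    {τ : ℝ} (hτ : τ ∈ Icc 0 t) (j : Fin n) (w : Fin n → ℝ) :
    fderiv ℝ (fun q => F.f τ t q q1 j) q0 w = dQ t (fU O t) (fg F t) (w, 0) (τ, (q0, q1)) j := by
  obtain ⟨L, hL, hLw⟩ := slab_comp (fU_open F t) (fg_smooth F t) hτ hq j
  rw [← hLw]
  exact fderiv_slice0 hL w

lemma fg_q1 (F : SmoothFamily B C O) {t : ℝ} {q0 q1 : Fin n → ℝ} (hq : (q0, q1) ∈ fU O t)
    {τ : ℝ} (hτ : τ ∈ Icc 0 t) (j : Fin n) (w : Fin n → ℝ) :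
    fderiv ℝ (fun q => F.f τ t q0 q j) q1 w = dQ t (fU O t) (fg F t) (0, w) (τ, (q0, q1)) j := by
  obtain ⟨L, hL, hLw⟩ := slab_comp (fU_open F t) (fg_smooth F t) hτ hq j
  rw [← hLw]
  exact fderiv_slice1 hL w

lemma fg_bdry0 (F : SmoothFamily B C O) {t : ℝ} (ht : 0 < t) {q} (hq : q ∈ fU O t)
    (w : (Fin n → ℝ) × (Fin n → ℝ)) :
    dQ t (fU O t) (fg F t) w (0, q) = w.1 := by
  have h1 := slab_hasFDeriv_Q (fU_open F t) (fg_smooth F t) (left_mem_Icc.2 ht.le) hq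
  have h2 : HasFDerivAt (fun x => fg F t (0, x))
      (ContinuousLinearMap.fst ℝ (Fin n → ℝ) (Fin n → ℝ)) q := by
    refine hasFDerivAt_fst.congr_of_eventuallyEq ?_
    filter_upwards [(fU_open F t).mem_nhds hq] with x hx
    exact F.bdry0 (t, x) hx
  exact congrArg (fun L => L w) (h1.unique h2)

lemma fg_bdry1 (F : SmoothFamily B C O) {t : ℝ} (ht : 0 < t) {q} (hq : q ∈ fU O t)
    (w : (Fin n → ℝ) × (Fin n → ℝ)) :
    dQ t (fU O t) (fg F t) w (t, q) = w.2 := by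
  have h1 := slab_hasFDeriv_Q (fU_open F t) (fg_smooth F t) (right_mem_Icc.2 ht.le) hq
  have h2 : HasFDerivAt (fun x => fg F t (t, x))
      (ContinuousLinearMap.snd ℝ (Fin n → ℝ) (Fin n → ℝ)) q := by
    refine hasFDerivAt_snd.congr_of_eventuallyEq ?_
    filter_upwards [(fU_open F t).mem_nhds hq] with x hx
    exact F.bdry1 (t, x) hx
  exact congrArg (fun L => L w) (h1.unique h2)

lemma fam_dS (hB : ∀ i, ContDiff ℝ (⊤ : ℕ∞) (B i)) (hC : ContDiff ℝ (⊤ : ℕ∞) C)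
    (F : SmoothFamily B C O) {t : ℝ} (ht : 0 < t) {q0 q1 : Fin n → ℝ} (hq : (q0, q1) ∈ fU O t)
    (m : Fin n) :
    fderiv ℝ (fun q1' => -(famS F t q0 q1')) q1 (Pi.single m 1)
      = -(dT t (fU O t) (fg F t) (t, (q0, q1)) m + B m q1) := by
  obtain ⟨L, hL, hLw⟩ := fam_action hB hC ht (fU_open F t) (fg_smooth F t) (fg_path F t)
    (fg_cl F t) hq
  have h1 : fderiv ℝ (fun q1' => -(famS F t q0 q1')) q1 (Pi.single m 1)
      = (-L) (0, Pi.single m 1) := fderiv_slice1 hL.neg (Pi.single m 1)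
  have h2 : fg F t (t, (q0, q1)) = q1 := F.bdry1 (t, q0, q1) hq
  rw [h1, ContinuousLinearMap.neg_apply, hLw]
  simp [fg_bdry0 F ht hq, fg_bdry1 F ht hq, h2, Pi.single_apply]

lemma fam_Hess (hB : ∀ i, ContDiff ℝ (⊤ : ℕ∞) (B i)) (hC : ContDiff ℝ (⊤ : ℕ∞) C)
    (F : SmoothFamily B C O) {t : ℝ} (ht : 0 < t) {q0 q1 : Fin n → ℝ} (hq : (q0, q1) ∈ fU O t)
    (l m : Fin n) :
    Hess01 (fun a b c => -(famS F a b c)) t q0 q1 l m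
      = - dQ t (fU O t) (dT t (fU O t) (fg F t)) (Pi.single l 1, 0) (t, (q0, q1)) m := by
  have hU := fU_open F t
  have hev : (fun q0' => fderiv ℝ (fun q1' => -(famS F t q0' q1')) q1 (Pi.single m 1))
      =ᶠ[nhds q0] fun q0' => -(dT t (fU O t) (fg F t) (t, (q0', q1)) m + B m q1) := by
    have hcont : Continuous fun q0' : Fin n → ℝ => (q0', q1) := by fun_prop
    have : ∀ᶠ q0' in nhds q0, (q0', q1) ∈ fU O t :=
      hcont.continuousAt.eventually_mem (hU.mem_nhds hq)
    filter_upwards [this] with x hx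
    exact fam_dS hB hC F ht hx m
  simp only [Hess01, Matrix.of_apply]
  rw [hev.fderiv_eq]
  obtain ⟨L, hL, hLw⟩ := slab_comp hU (slab_contDiff_dT ht hU (fg_smooth F t))
    (right_mem_Icc.2 ht.le) hq m
  rw [← hLw]
  exact fderiv_slice0 (h := fun q => -(dT t (fU O t) (fg F t) (t, q) m + B m q1))
    (L := -L) (hL.add_const _).neg (Pi.single l 1)

lemma Heav_pos {x : ℝ} (h : 0 < x) : Heav x = 1 := by
  simp [Heav, h.not_gt, h.ne']

lemma Heav_neg {x : ℝ} (h : x < 0) : Heav x = 0 := by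
  simp [Heav, h]

end final

/-- Lemma 2.1.9: `-G_γ` is a Green's function for the Jacobi operator
with Dirichlet boundary conditions. -/
theorem statement1 {n : ℕ} (hn : 1 ≤ n)
    (B : Fin n → (Fin n → ℝ) → ℝ) (C : (Fin n → ℝ) → ℝ)
    (hB : ∀ i, ContDiff ℝ (⊤ : ℕ∞) (B i)) (hC : ContDiff ℝ (⊤ : ℕ∞) C)
    (O : Set (ℝ × (Fin n → ℝ) × (Fin n → ℝ))) (F : SmoothFamily B C O)
    (t : ℝ) (q0 q1 : Fin n → ℝ) (hmem : (t, q0, q1) ∈ O) :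
    (∀ ς ∈ Icc (0:ℝ) t, ∀ τ ∈ Icc (0:ℝ) t, ∀ i j : Fin n,
      (ς = 0 ∨ ς = t ∨ τ = 0 ∨ τ = t) → Green F t q0 q1 ς τ i j = 0) ∧
    (∀ ξ : ℝ → Fin n → ℝ, ContDiff ℝ (⊤ : ℕ∞) ξ → ξ 0 = 0 → ξ t = 0 →
      ∀ ς ∈ Icc (0:ℝ) t, ∀ i : Fin n,
        (∑ j, ∫ τ in (0:ℝ)..t,
            Green F t q0 q1 ς τ i j * Jacobi B C (fun σ => F.f σ t q0 q1) ξ τ j)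
          = -(ξ ς i)) := by
  have ht : 0 < t := F.pos _ hmem
  have hq : (q0, q1) ∈ fU O t := hmem
  have hU := fU_open F t
  have hg := fg_smooth F t
  set H := Hess01 (fun a b c => -(famS F a b c)) t q0 q1 with hH
  set φ : Fin n → ℝ → Fin n → ℝ := fun k τ =>
    dQ t (fU O t) (fg F t) (Pi.single k 1, 0) (τ, (q0, q1)) with hφ
  set ψ : Fin n → ℝ → Fin n → ℝ := fun k τ =>
    dQ t (fU O t) (fg F t) (0, Pi.single k 1) (τ, (q0, q1)) with hψ
  have hG : ∀ ς ∈ Icc (0:ℝ) t, ∀ τ ∈ Icc (0:ℝ) t, ∀ i j, Green F t q0 q1 ς τ i j =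
      Heav (ς - τ) * (∑ k, ∑ l, φ k ς i * (H.transpose)⁻¹ k l * ψ l τ j)
      + Heav (τ - ς) * (∑ k, ∑ l, ψ k ς i * H⁻¹ k l * φ l τ j) := by
    intro ς hς τ hτ i j
    simp only [Green, fg_q0 F hq hς, fg_q1 F hq hς, fg_q0 F hq hτ, fg_q1 F hq hτ]
    rfl
  have hφ0 : ∀ k i, φ k 0 i = (Pi.single k 1 : Fin n → ℝ) i := fun k i => by
    simp only [hφ, fg_bdry0 F ht hq]
  have hφt : ∀ k i, φ k t i = 0 := fun k i => by
    simp [hφ, fg_bdry1 F ht hq]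
  have hψ0 : ∀ k i, ψ k 0 i = 0 := fun k i => by
    simp [hψ, fg_bdry0 F ht hq]
  have hψt : ∀ k i, ψ k t i = (Pi.single k 1 : Fin n → ℝ) i := fun k i => by
    simp only [hψ, fg_bdry1 F ht hq]
  refine ⟨?_, ?_⟩
  · intro ς hς τ hτ i j h
    rw [hG ς hς τ hτ]
    have h1 : Heav (ς - τ) * (∑ k, ∑ l, φ k ς i * (H.transpose)⁻¹ k l * ψ l τ j) = 0 := by
      rcases lt_or_ge ς τ with hlt | hle
      · rw [Heav_neg (by linarith), zero_mul]
      · have h' : ς = t ∨ τ = 0 := by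
          rcases h with h | h | h | h
          · right; linarith [hτ.1]
          · left; exact h
          · right; exact h
          · left; linarith [hς.2]
        rcases h' with h | h
        · subst h; simp [hφt]
        · subst h; simp [hψ0]
    have h2 : Heav (τ - ς) * (∑ k, ∑ l, ψ k ς i * H⁻¹ k l * φ l τ j) = 0 := by
      rcases lt_or_ge τ ς with hlt | hle
      · rw [Heav_neg (by linarith), zero_mul]
      · have h' : ς = 0 ∨ τ = t := by
          rcases h with h | h | h | h
          · left; exact h
          · right; linarith [hτ.2]
          · left; linarith [hς.1]
          · right; exact h
        rcases h' with h | h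
        · subst h; simp [hψ0]
        · subst h; simp [hφt]
    rw [h1, h2, add_zero]
  · intro ξ hξ hξ0 hξt ς hς i
    set γ : ℝ → Fin n → ℝ := fun σ => fg F t (σ, (q0, q1)) with hγdef
    have hγ : ContDiff ℝ (⊤ : ℕ∞) γ := fg_path F t _ hq
    have hco := coef_path hB hC hγ t
    set J : ℝ → Fin n → ℝ := fun τ j =>
      Dop (cF B γ) (cM B C γ) ξ (deriv ξ) (deriv (deriv ξ)) τ j with hJ
    have hJc : ∀ j, ContinuousOn (fun τ => J τ j) (Icc 0 t) := by
      intro j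
      have hξ1 := path_deriv_smooth hξ
      have hξ2 := path_deriv_smooth hξ1
      refine ContinuousOn.add (ContinuousOn.add ?_ ?_) ?_
      · exact ((continuous_apply j).comp hξ2.continuous).continuousOn
      · exact continuousOn_finsetSum _ fun k _ => (hco.cF j k).mul
          ((continuous_apply k).comp hξ1.continuous).continuousOn
      · exact continuousOn_finsetSum _ fun k _ => (hco.cM j k).mul
          ((continuous_apply k).comp hξ.continuous).continuousOn
    have jφ := fun k => fam_JD ht hU hg hq ((Pi.single k 1 : Fin n → ℝ), (0 : Fin n → ℝ))
    have jψ := fun k => fam_JD ht hU hg hq ((0 : Fin n → ℝ), (Pi.single k 1 : Fin n → ℝ))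
    have dφ := fun k τ (hτ : τ ∈ Ioo 0 t) i => fam_Dop hB hC ht hU hg (fg_path F t) (fg_cl F t) hq
      ((Pi.single k 1 : Fin n → ℝ), (0 : Fin n → ℝ)) (Ioo_subset_Icc_self hτ) i
    have dψ := fun k τ (hτ : τ ∈ Ioo 0 t) i => fam_Dop hB hC ht hU hg (fg_path F t) (fg_cl F t) hq
      ((0 : Fin n → ℝ), (Pi.single k 1 : Fin n → ℝ)) (Ioo_subset_Icc_self hτ) i
    have hHe := fam_Hess hB hC F ht hq
    have hu : IsUnit H.det := core_det ht hco jφ dφ hφ0 hφt H hHe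
    have core := core_green hco jφ jψ dφ dψ hφt hψ0 hψt H hHe hu ξ (deriv ξ) hς i
    have jξ := path_JD hξ t
    have i1 : ∀ l, ∫ τ in (0:ℝ)..ς, ∑ j, ψ l τ j * J τ j
        = Wr (cF B γ) (ψ l) (fun τ => dQ t (fU O t) (dT t (fU O t) (fg F t))
          (0, Pi.single l 1) (τ, (q0, q1))) ξ (deriv ξ) ς := by
      intro l
      refine (Wr_integral hco (jψ l) jξ (dψ l) hJc le_rfl hς.1 hς.2).trans ?_
      have : Wr (cF B γ) (ψ l) (fun τ => dQ t (fU O t) (dT t (fU O t) (fg F t))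
          (0, Pi.single l 1) (τ, (q0, q1))) ξ (deriv ξ) 0 = 0 := by
        simp [Wr, hψ0, hξ0]
      exact (congrArg (fun z => _ - z) this).trans (sub_zero _)
    have i2 : ∀ l, ∫ τ in ς..t, ∑ j, φ l τ j * J τ j
        = - Wr (cF B γ) (φ l) (fun τ => dQ t (fU O t) (dT t (fU O t) (fg F t))
          (Pi.single l 1, 0) (τ, (q0, q1))) ξ (deriv ξ) ς := by
      intro l
      refine (Wr_integral hco (jφ l) jξ (dφ l) hJc hς.1 hς.2 le_rfl).trans ?_
      have : Wr (cF B γ) (φ l) (fun τ => dQ t (fU O t) (dT t (fU O t) (fg F t))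
          (Pi.single l 1, 0) (τ, (q0, q1))) ξ (deriv ξ) t = 0 := by
        simp [Wr, hφt, hξt]
      exact (congrArg (fun z => z - _) this).trans (zero_sub _)
    have s1 := Icc_subset_Icc (le_refl (0:ℝ)) hς.2
    have s2 := Icc_subset_Icc hς.1 (le_refl t)
    have hsplit : ∀ j, ∫ τ in (0:ℝ)..t,
        Green F t q0 q1 ς τ i j * Jacobi B C (fun σ => F.f σ t q0 q1) ξ τ j
        = (∫ τ in (0:ℝ)..ς, (∑ k, ∑ l, φ k ς i * (H.transpose)⁻¹ k l * ψ l τ j) * J τ j)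
        + ∫ τ in ς..t, (∑ k, ∑ l, ψ k ς i * H⁻¹ k l * φ l τ j) * J τ j := by
      intro j
      have e1 : EqOn (fun τ => (∑ k, ∑ l, φ k ς i * (H.transpose)⁻¹ k l * ψ l τ j) * J τ j)
          (fun τ => Green F t q0 q1 ς τ i j * Jacobi B C (fun σ => F.f σ t q0 q1) ξ τ j)
          (uIoo 0 ς) := by
        intro τ hτ
        rw [uIoo_of_le hς.1] at hτ
        simp only
        rw [hG ς hς τ (s1 (Ioo_subset_Icc_self hτ)), Heav_pos (by linarith [hτ.2]),
          Heav_neg (by linarith [hτ.2]), one_mul, zero_mul, add_zero]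
        rfl
      have e2 : EqOn (fun τ => (∑ k, ∑ l, ψ k ς i * H⁻¹ k l * φ l τ j) * J τ j)
          (fun τ => Green F t q0 q1 ς τ i j * Jacobi B C (fun σ => F.f σ t q0 q1) ξ τ j)
          (uIoo ς t) := by
        intro τ hτ
        rw [uIoo_of_le hς.2] at hτ
        simp only
        rw [hG ς hς τ (s2 (Ioo_subset_Icc_self hτ)), Heav_neg (by linarith [hτ.1] : ς - τ < 0),
          Heav_pos (by linarith [hτ.1] : 0 < τ - ς), one_mul, zero_mul, zero_add]
        rfl
      have n1 : IntervalIntegrable (fun τ =>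
          (∑ k, ∑ l, φ k ς i * (H.transpose)⁻¹ k l * ψ l τ j) * J τ j) volume 0 ς := by
        apply ContinuousOn.intervalIntegrable
        rw [uIcc_of_le hς.1]
        refine ContinuousOn.mul ?_ ((hJc j).mono s1)
        exact continuousOn_finsetSum _ fun k _ => continuousOn_finsetSum _ fun l _ =>
          (((jψ l).cx j).mono s1).const_mul _
      have n2 : IntervalIntegrable (fun τ =>
          (∑ k, ∑ l, ψ k ς i * H⁻¹ k l * φ l τ j) * J τ j) volume ς t := by
        apply ContinuousOn.intervalIntegrable
        rw [uIcc_of_le hς.2]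
        refine ContinuousOn.mul ?_ ((hJc j).mono s2)
        exact continuousOn_finsetSum _ fun k _ => continuousOn_finsetSum _ fun l _ =>
          (((jφ l).cx j).mono s2).const_mul _
      rw [← intervalIntegral.integral_add_adjacent_intervals (n1.congr_uIoo e1)
        (n2.congr_uIoo e2), intervalIntegral.integral_congr_uIoo e1,
        intervalIntegral.integral_congr_uIoo e2]
    simp only [hsplit]
    rw [Finset.sum_add_distrib,
      sum_integral hς.1 (fun k => φ k ς i) _ ψ J (fun l j => ((jψ l).cx j).mono s1)
        (fun j => (hJc j).mono s1),
      sum_integral hς.2 (fun k => ψ k ς i) _ φ J (fun l j => ((jφ l).cx j).mono s2)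
        (fun j => (hJc j).mono s2)]
    simp only [i1, i2]
    exact core
end
end
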